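/- arXiv:2003.09397 — 2 statements merged into one kernel-verified Lean document; each statement's English description precedes it below -/
import Mathlib

section
/- Fix integers N ≥ 2 and 1 ≤ K ≤ N − 1, and for p₀ ∈ (0, p_*) let (q₁(p₀;K), q_N(p₀;K)) be the unique pair with q₁ > 0 and q_N ∈ (0, √A(p₀)) solving T₊(p₀, q₁) = T₋(p₀, q_N) and 2K q₁ − 2(N − K) q_N = √A(p₀). Then T₊(p₀, q₁(p₀;K)) → ∞ as p₀ → 0⁺, and there exists p_∞ ∈ (0, p_*) such that the map p₀ ↦ T₊(p₀, q₁(p₀;K)) is strictly decreasing on (0, p_∞). -/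
open Real MeasureTheory Set Filter Topology

/-- The potential `A(u) = u²(1 − u²)`. -/
noncomputable def A (u : ℝ) : ℝ := u ^ 2 * (1 - u ^ 2)

/-- `p⋆ = 1/√2`, the unique positive critical point of `A`, with `A p⋆ = 1/4`. -/
noncomputable def pstar : ℝ := 1 / Real.sqrt 2

/-- For energy `E > −1/4`, the unique root `p₊ > p⋆` of `A(p₊) = −E` (explicit formula). -/
noncomputable def pPlus (E : ℝ) : ℝ := Real.sqrt ((1 + Real.sqrt (1 + 4 * E)) / 2)

/-- For energy `E ∈ (−1/4, 0)`, the unique root `p₋ ∈ (0, p⋆)` of `A(p₋) = −E` (explicit formula). -/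
noncomputable def pMinus (E : ℝ) : ℝ := Real.sqrt ((1 - Real.sqrt (1 + 4 * E)) / 2)

/-- The period function `T₊(p₀,q₀) = ∫_{p₀}^{p₊} du/√(E + A(u))`, `E = q₀² − A(p₀)`. -/
noncomputable def Tplus (p₀ q₀ : ℝ) : ℝ :=
  ∫ u in p₀..pPlus (q₀ ^ 2 - A p₀), 1 / Real.sqrt ((q₀ ^ 2 - A p₀) + A u)

/-- The period function `T₋(p₀,q₀) = ∫_{p₋}^{p₀} du/√(E + A(u))`, `E = q₀² − A(p₀)`. -/
noncomputable def Tminus (p₀ q₀ : ℝ) : ℝ :=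
  ∫ u in pMinus (q₀ ^ 2 - A p₀)..p₀, 1 / Real.sqrt ((q₀ ^ 2 - A p₀) + A u)

theorem integral_sech_substitution {p P : ℝ} (hp : 0 < p) (hpP : p < P) :
    ∫ u in p..P, 1 / √(-A P + A u) =
      ∫ t in 0..arcosh (P / p), 1 / √(P ^ 2 + (P ^ 2 - 1) * cosh t ^ 2) := by
  have hP : 0 < P := hp.trans hpP
  have hPp : 1 < P / p := (one_lt_div hp).2 hpP
  have hτ : 0 < arcosh (P / p) := arcosh_pos hPp
  have hcosh : cosh (arcosh (P / p)) = P / p := cosh_arcosh hPp.le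
  have himage : (fun t => P / cosh t) '' Ioo 0 (arcosh (P / p)) = Ioo p P := by
    ext u
    constructor
    · rintro ⟨t, ⟨ht0, ht1⟩, rfl⟩
      have h1 : 1 < cosh t := one_lt_cosh.2 ht0.ne'
      have h2 : cosh t < P / p := by
        rw [← hcosh, cosh_lt_cosh, abs_of_pos ht0, abs_of_pos hτ]; exact ht1
      rw [lt_div_iff₀ hp] at h2
      exact ⟨by rw [lt_div_iff₀ (by linarith)]; linarith, div_lt_self hP h1⟩
    · rintro ⟨h1, h2⟩
      have hu : 0 < u := hp.trans h1
      have hPu : 1 < P / u := (one_lt_div hu).2 h2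
      refine ⟨arcosh (P / u), ⟨arcosh_pos hPu, ?_⟩, ?_⟩
      · rw [arcosh_lt_arcosh (by positivity) (by positivity)]
        exact div_lt_div_of_pos_left hP hp h1
      · simp only [cosh_arcosh hPu.le]
        field_simp
  have hinj : InjOn (fun t => P / cosh t) (Ioo 0 (arcosh (P / p))) := by
    intro x hx y hy hxy
    have h : cosh x = cosh y := by
      have hx' := (cosh_pos x).ne'
      have hy' := (cosh_pos y).ne'
      simp only at hxy
      field_simp at hxy
      exact hxy.symm
    rw [← arcosh_cosh hx.1.le, h, arcosh_cosh hy.1.le]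
  rw [intervalIntegral.integral_of_le hpP.le, intervalIntegral.integral_of_le hτ.le,
    integral_Ioc_eq_integral_Ioo, integral_Ioc_eq_integral_Ioo, ← himage,
    integral_image_eq_integral_abs_deriv_smul (f' := fun t => -(P * sinh t) / cosh t ^ 2)
      measurableSet_Ioo _ hinj]
  · refine setIntegral_congr_fun measurableSet_Ioo fun t ht => ?_
    have hs : 0 < sinh t := sinh_pos_iff.2 ht.1
    have hc : 0 < cosh t := cosh_pos t
    have hA : -A P + A (P / cosh t) =
        (P * sinh t / cosh t ^ 2) ^ 2 * (P ^ 2 + (P ^ 2 - 1) * cosh t ^ 2) := by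
      have hs2 : (P * sinh t / cosh t ^ 2) ^ 2 = P ^ 2 * (cosh t ^ 2 - 1) / cosh t ^ 4 := by
        rw [show cosh t ^ 2 - 1 = sinh t ^ 2 by linarith [cosh_sq t]]; ring
      rw [hs2]
      unfold A
      field_simp
      ring
    have habs : |-(P * sinh t) / cosh t ^ 2| = P * sinh t / cosh t ^ 2 := by
      rw [neg_div, abs_neg, abs_of_pos (by positivity)]
    simp only [smul_eq_mul]
    rw [hA, habs, Real.sqrt_mul (by positivity), Real.sqrt_sq (by positivity)]
    field_simp
  · intro t _
    have := (hasDerivAt_const t P).fun_div (hasDerivAt_cosh t) (cosh_pos t).ne'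
    rw [zero_mul, zero_sub] at this
    exact this.hasDerivWithinAt

theorem integral_cosh_substitution {m p : ℝ} (hm : 0 < m) (hmp : m < p) :
    ∫ u in m..p, 1 / √(-A m + A u) =
      ∫ t in 0..arcosh (p / m), 1 / √(1 - m ^ 2 - m ^ 2 * cosh t ^ 2) := by
  have hp : 0 < p := hm.trans hmp
  have hpm : 1 < p / m := (one_lt_div hm).2 hmp
  have hη : 0 < arcosh (p / m) := arcosh_pos hpm
  have hcosh : cosh (arcosh (p / m)) = p / m := cosh_arcosh hpm.le
  have himage : (fun t => m * cosh t) '' Ioo 0 (arcosh (p / m)) = Ioo m p := by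
    ext u
    constructor
    · rintro ⟨t, ⟨ht0, ht1⟩, rfl⟩
      have h1 : 1 < cosh t := one_lt_cosh.2 ht0.ne'
      have h2 : cosh t < p / m := by
        rw [← hcosh, cosh_lt_cosh, abs_of_pos ht0, abs_of_pos hη]; exact ht1
      rw [lt_div_iff₀ hm] at h2
      exact ⟨by nlinarith, by linarith⟩
    · rintro ⟨h1, h2⟩
      have hum : 1 < u / m := (one_lt_div hm).2 h1
      have hu : 0 < u := hm.trans h1
      refine ⟨arcosh (u / m), ⟨arcosh_pos hum, ?_⟩, ?_⟩
      · rw [arcosh_lt_arcosh (by positivity) (by positivity)]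
        exact div_lt_div_of_pos_right h2 hm
      · simp only [cosh_arcosh hum.le]
        field_simp
  have hinj : InjOn (fun t => m * cosh t) (Ioo 0 (arcosh (p / m))) := by
    intro x hx y hy hxy
    have h : cosh x = cosh y := mul_left_cancel₀ hm.ne' hxy
    rw [← arcosh_cosh hx.1.le, h, arcosh_cosh hy.1.le]
  rw [intervalIntegral.integral_of_le hmp.le, intervalIntegral.integral_of_le hη.le,
    integral_Ioc_eq_integral_Ioo, integral_Ioc_eq_integral_Ioo, ← himage,
    integral_image_eq_integral_abs_deriv_smul (f' := fun t => m * sinh t)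
      measurableSet_Ioo _ hinj]
  · refine setIntegral_congr_fun measurableSet_Ioo fun t ht => ?_
    have hs : 0 < sinh t := sinh_pos_iff.2 ht.1
    have hA : -A m + A (m * cosh t) =
        (m * sinh t) ^ 2 * (1 - m ^ 2 - m ^ 2 * cosh t ^ 2) := by
      unfold A
      have := cosh_sq t
      rw [mul_pow m (sinh t), show sinh t ^ 2 = cosh t ^ 2 - 1 by linarith]
      ring
    simp only [smul_eq_mul]
    rw [hA, abs_of_pos (by positivity), Real.sqrt_mul (by positivity),
      Real.sqrt_sq (by positivity)]
    field_simp
  · intro t _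
    exact ((hasDerivAt_cosh t).const_mul m).hasDerivWithinAt

/-- The squared reciprocal of the integrand of `T₊` in the variable `x = τ - t`, `u = p₊ / cosh t`,
where `e = (p₊² - 1) / p₀²` and `cosh τ = p₊ / p₀`. -/
noncomputable def weight (τ e x : ℝ) : ℝ :=
  (1 + e * (cosh (τ - x) / cosh τ) ^ 2) / (1 - e / cosh τ ^ 2)

noncomputable def weightedTime (τ e : ℝ) : ℝ := ∫ x in 0..τ, 1 / √(weight τ e x)

theorem sq_lt_half_of_mem {p : ℝ} (hp : p ∈ Ioo 0 pstar) : p ^ 2 < 1 / 2 := by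
  have h : pstar ^ 2 = 1 / 2 := by simp [pstar]
  rw [← h]
  exact pow_lt_pow_left₀ hp.2 hp.1.le two_ne_zero

theorem exists_weightedTime_eq {p q : ℝ} (hp : p ∈ Ioo 0 pstar) :
    ∃ e τ, 0 < τ ∧ cosh τ ^ 2 = 1 / p ^ 2 + e ∧
      q ^ 2 = p ^ 2 * (1 + e) * (1 + e * p ^ 2 - p ^ 2) ∧ 1 / 2 ≤ 1 + e * p ^ 2 ∧
      Tplus p q = weightedTime τ e := by
  have hp2 := sq_lt_half_of_mem hp
  have hp0 : 0 < p := hp.1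
  set E := q ^ 2 - A p with hE
  have hE4 : 0 ≤ 1 + 4 * E := by
    have : A p ≤ 1 / 4 := by unfold A; nlinarith [sq_nonneg (p ^ 2 - 1 / 2)]
    nlinarith [sq_nonneg q]
  set P := pPlus E with hPdef
  have hP2 : P ^ 2 = (1 + √(1 + 4 * E)) / 2 := by
    rw [hPdef, pPlus, Real.sq_sqrt (by positivity)]
  have hPhalf : 1 / 2 ≤ P ^ 2 := by rw [hP2]; linarith [Real.sqrt_nonneg (1 + 4 * E)]
  have hP0 : 0 ≤ P := Real.sqrt_nonneg _
  have hpP : p < P := lt_of_pow_lt_pow_left₀ 2 hP0 (by linarith)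
  have hAP : A P = -E := by
    unfold A
    have := Real.sq_sqrt hE4
    rw [hP2]
    nlinarith
  have hPp : 1 < P / p := (one_lt_div hp0).2 hpP
  have hcosh : cosh (arcosh (P / p)) = P / p := cosh_arcosh hPp.le
  refine ⟨(P ^ 2 - 1) / p ^ 2, arcosh (P / p), arcosh_pos hPp, ?_, ?_, ?_, ?_⟩
  · rw [hcosh]; field_simp; ring
  · have : q ^ 2 = -A P + A p := by rw [hAP, hE]; ring
    rw [this]
    unfold A
    field_simp
    ring
  · rw [div_mul_cancel₀ _ (by positivity)]; linarith
  · have h1 : Tplus p q = ∫ u in p..P, 1 / √(-A P + A u) := by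
      rw [hAP, neg_neg]; rfl
    rw [h1, integral_sech_substitution hp0 hpP, weightedTime]
    have hreflect := intervalIntegral.integral_comp_sub_left (a := 0) (b := arcosh (P / p))
      (fun t => 1 / √(P ^ 2 + (P ^ 2 - 1) * cosh t ^ 2)) (arcosh (P / p))
    rw [sub_self, sub_zero] at hreflect
    rw [← hreflect]
    refine intervalIntegral.integral_congr fun x _ => ?_
    simp only [weight, hcosh]
    congr 2
    have hPpos : 0 < P := hp0.trans hpP
    have : 1 - (P ^ 2 - 1) / p ^ 2 / (P / p) ^ 2 = 1 / P ^ 2 := by field_simp; ring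
    rw [this]
    field_simp

theorem exists_Tminus_eq {p q : ℝ} (hp : p ∈ Ioo 0 pstar) (hq : q ∈ Ioo 0 √(A p)) :
    ∃ m η, 0 < m ∧ m < p ∧ 0 < η ∧ cosh η = p / m ∧ A m = A p - q ^ 2 ∧
      Tminus p q = ∫ t in 0..η, 1 / √(1 - m ^ 2 - m ^ 2 * cosh t ^ 2) := by
  have hp2 := sq_lt_half_of_mem hp
  have hp0 : 0 < p := hp.1
  have hAp : 0 < A p := by
    have : 0 < 1 - p ^ 2 := by linarith
    unfold A; positivity
  have hq2 : q ^ 2 < A p := by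
    rw [← Real.sq_sqrt hAp.le]
    exact pow_lt_pow_left₀ hq.2 hq.1.le two_ne_zero
  have hq20 : 0 < q ^ 2 := pow_pos hq.1 2
  set E := q ^ 2 - A p with hE
  have hE4 : 0 ≤ 1 + 4 * E := by
    have : A p ≤ 1 / 4 := by unfold A; nlinarith [sq_nonneg (p ^ 2 - 1 / 2)]
    nlinarith
  have hs1 : √(1 + 4 * E) < 1 := by
    rw [Real.sqrt_lt' one_pos]; linarith
  set m := pMinus E with hm
  have hm2 : m ^ 2 = (1 - √(1 + 4 * E)) / 2 := by
    rw [hm, pMinus, Real.sq_sqrt (by linarith)]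
  have hm0 : 0 < m := Real.sqrt_pos.2 (by linarith)
  have hAm : A m = -E := by
    unfold A
    have := Real.sq_sqrt hE4
    rw [hm2]
    nlinarith
  have hmp : m < p := by
    refine lt_of_pow_lt_pow_left₀ 2 hp0.le ?_
    have hm2' : m ^ 2 ≤ 1 / 2 := by rw [hm2]; linarith [Real.sqrt_nonneg (1 + 4 * E)]
    have : 0 < (p ^ 2 - m ^ 2) * (1 - m ^ 2 - p ^ 2) := by
      have : (p ^ 2 - m ^ 2) * (1 - m ^ 2 - p ^ 2) = A p - A m := by unfold A; ring
      rw [this, hAm, hE]; linarith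
    have h := (mul_pos_iff_of_pos_right (by linarith)).1 this
    linarith
  have hpm : 1 < p / m := (one_lt_div hm0).2 hmp
  refine ⟨m, arcosh (p / m), hm0, hmp, arcosh_pos hpm, cosh_arcosh hpm.le, ?_, ?_⟩
  · rw [hAm, hE]; ring
  · rw [← integral_cosh_substitution hm0 hmp, hAm, neg_neg]
    rfl

theorem add_sq_half_le_cosh (x : ℝ) (hx : 0 ≤ x) : 1 + x ^ 2 / 2 ≤ cosh x := by
  have h1 : cosh x = cosh (x / 2) ^ 2 + sinh (x / 2) ^ 2 := by
    rw [← cosh_two_mul]; congr 1; ring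
  have h2 := cosh_sq (x / 2)
  have h3 : x / 2 ≤ sinh (x / 2) := self_le_sinh_iff.2 (by linarith)
  have h4 : (x / 2) ^ 2 ≤ sinh (x / 2) ^ 2 := pow_le_pow_left₀ (by linarith) h3 2
  linarith

theorem le_cosh_of_nonneg {x : ℝ} (hx : 0 ≤ x) : x ≤ cosh x := by
  nlinarith [add_sq_half_le_cosh x hx, sq_nonneg (x - 1)]

theorem abs_inv_sqrt_sub_le {s w w' : ℝ} (hs : 1 ≤ s) (hw : 1 ≤ s * w) (hw' : 1 ≤ s * w') :
    |1 / √w - 1 / √w'| ≤ s ^ 2 * |w - w'| := by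
  have hw0 : 0 < w := by by_contra! h; nlinarith
  have hw0' : 0 < w' := by by_contra! h; nlinarith
  obtain ⟨a, ha, rfl⟩ : ∃ a, 0 < a ∧ a ^ 2 = w := ⟨√w, sqrt_pos.2 hw0, sq_sqrt hw0.le⟩
  obtain ⟨b, hb, rfl⟩ : ∃ b, 0 < b ∧ b ^ 2 = w' := ⟨√w', sqrt_pos.2 hw0', sq_sqrt hw0'.le⟩
  rw [sqrt_sq ha.le, sqrt_sq hb.le]
  have h1 : 1 / a - 1 / b = -((a - b) / (a * b)) := by field_simp; ring
  have h2 : a ^ 2 - b ^ 2 = (a - b) * (a + b) := by ring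
  rw [h1, abs_neg, abs_div, abs_of_pos (mul_pos ha hb), h2, abs_mul, abs_of_pos (add_pos ha hb),
    div_le_iff₀ (mul_pos ha hb)]
  have hsa : 1 ≤ s * a := by
    refine le_of_sq_le_sq ?_ (by positivity)
    nlinarith
  have hsab : 1 ≤ s * (a * b) := by
    refine le_of_sq_le_sq ?_ (by positivity)
    nlinarith
  have h3 : 1 ≤ s ^ 2 * (a + b) * (a * b) := by
    have : s ^ 2 * (a + b) * (a * b) = (s * a + s * b) * (s * (a * b)) := by ring
    rw [this]
    have : 0 < s * b := by positivity
    nlinarith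
  calc |a - b| = |a - b| * 1 := (mul_one _).symm
    _ ≤ |a - b| * (s ^ 2 * (a + b) * (a * b)) := by gcongr
    _ = _ := by ring

theorem le_inv_sqrt_sub {s w w' : ℝ} (hs : 1 ≤ s) (hw : 0 < w) (hww' : w ≤ w') (hw' : w' ≤ s) :
    (w' - w) / (2 * s ^ 2) ≤ 1 / √w - 1 / √w' := by
  obtain ⟨a, ha, rfl⟩ : ∃ a, 0 < a ∧ a ^ 2 = w := ⟨√w, sqrt_pos.2 hw, sq_sqrt hw.le⟩
  obtain ⟨b, hb, rfl⟩ : ∃ b, 0 < b ∧ b ^ 2 = w' :=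
    ⟨√w', sqrt_pos.2 (hw.trans_le hww'), sq_sqrt (hw.trans_le hww').le⟩
  rw [sqrt_sq ha.le, sqrt_sq hb.le]
  have hab : a ≤ b := le_of_sq_le_sq hww' hb.le
  have h1 : 1 / a - 1 / b = (b - a) / (a * b) := by field_simp
  have hbs : b ≤ s := by nlinarith
  have h2 : a * b * (a + b) ≤ 2 * s ^ 2 := by
    have : a * b ≤ s := by nlinarith
    calc a * b * (a + b) ≤ s * (s + s) := by gcongr; linarith
      _ = _ := by ring
  rw [h1, div_le_div_iff₀ (by positivity) (by positivity)]
  calc (b ^ 2 - a ^ 2) * (a * b) = (b - a) * (a * b * (a + b)) := by ring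
    _ ≤ (b - a) * (2 * s ^ 2) := by gcongr

theorem cosh_ratio_mem {τ x : ℝ} (hx : x ∈ Icc 0 τ) :
    1 / cosh τ ≤ cosh (τ - x) / cosh τ ∧ cosh (τ - x) / cosh τ ≤ 1 := by
  have hc := cosh_pos τ
  constructor
  · gcongr; exact one_le_cosh _
  · rw [div_le_one hc, cosh_le_cosh, abs_of_nonneg (by linarith [hx.2]),
      abs_of_nonneg (hx.1.trans hx.2)]
    linarith [hx.1]

theorem one_sub_div_cosh_sq_mem {C τ e : ℝ} (hC : 1 ≤ C) (he : 1 ≤ C * (1 + e)) (he' : 1 + e ≤ C)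
    (hτ : 2 * C ≤ cosh τ ^ 2) :
    1 / 2 ≤ 1 - e / cosh τ ^ 2 ∧ 1 - e / cosh τ ^ 2 ≤ 3 / 2 := by
  have hc : 0 < cosh τ ^ 2 := pow_pos (cosh_pos τ) 2
  have he0 : 0 < 1 + e := by by_contra! h; nlinarith
  have h1 : e / cosh τ ^ 2 ≤ 1 / 2 := by rw [div_le_iff₀ hc]; linarith
  have h2 : -(1 / 2) ≤ e / cosh τ ^ 2 := by rw [le_div_iff₀ hc]; linarith
  constructor <;> linarith

theorem one_add_mul_sq_mem {C e z : ℝ} (hC : 1 ≤ C) (he : 1 ≤ C * (1 + e)) (he' : 1 + e ≤ C)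
    (hz0 : 0 ≤ z) (hz : z ≤ 1) : 1 ≤ C * (1 + e * z ^ 2) ∧ 1 + e * z ^ 2 ≤ C := by
  have hz2 : z ^ 2 ≤ 1 := by nlinarith
  have hz20 := sq_nonneg z
  constructor
  · nlinarith
  · nlinarith

theorem weight_mem {C τ e x : ℝ} (hC : 1 ≤ C) (he : 1 ≤ C * (1 + e)) (he' : 1 + e ≤ C)
    (hτ : 2 * C ≤ cosh τ ^ 2) (hx : x ∈ Icc 0 τ) :
    1 ≤ 2 * C * weight τ e x ∧ weight τ e x ≤ 2 * C := by
  have hz := cosh_ratio_mem hx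
  have hz0 : 0 ≤ cosh (τ - x) / cosh τ := le_trans (by have := cosh_pos τ; positivity) hz.1
  have hn := one_add_mul_sq_mem hC he he' hz0 hz.2
  have hd := one_sub_div_cosh_sq_mem hC he he' hτ
  have hd0 : 0 < 1 - e / cosh τ ^ 2 := by linarith [hd.1]
  unfold weight
  constructor
  · rw [← mul_div_assoc, one_le_div hd0]; linarith
  · rw [div_le_iff₀ hd0]; nlinarith

theorem continuousOn_inv_sqrt_weight {C τ e : ℝ} (hC : 1 ≤ C) (he : 1 ≤ C * (1 + e))
    (he' : 1 + e ≤ C) (hτ : 2 * C ≤ cosh τ ^ 2) :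
    ContinuousOn (fun x => 1 / √(weight τ e x)) (Icc 0 τ) := by
  have hcont : Continuous (weight τ e) := by
    unfold weight
    have : Continuous fun x => cosh (τ - x) := continuous_cosh.comp (by fun_prop)
    fun_prop
  refine continuousOn_const.div (hcont.sqrt.continuousOn) fun x hx => ?_
  have h := (weight_mem hC he he' hτ hx).1
  refine (sqrt_pos.2 ?_).ne'
  by_contra! hw
  nlinarith

theorem intervalIntegrable_inv_sqrt_weight {C τ e a b : ℝ} (hC : 1 ≤ C) (he : 1 ≤ C * (1 + e))
    (he' : 1 + e ≤ C) (hτ : 2 * C ≤ cosh τ ^ 2) (ha : 0 ≤ a) (hab : a ≤ b) (hb : b ≤ τ) :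
    IntervalIntegrable (fun x => 1 / √(weight τ e x)) volume a b := by
  refine ContinuousOn.intervalIntegrable ?_
  rw [uIcc_of_le hab]
  exact (continuousOn_inv_sqrt_weight hC he he' hτ).mono (Icc_subset_Icc ha hb)

theorem inv_sqrt_mem {s w : ℝ} (hs : 1 ≤ s) (hw : 1 ≤ s * w) (hw' : w ≤ s) :
    1 / s ≤ 1 / √w ∧ 1 / √w ≤ s := by
  have hw0 : 0 < w := by by_contra! h; nlinarith
  have hr := sqrt_pos.2 hw0
  have hsq := sq_sqrt hw0.le
  constructor
  · refine one_div_le_one_div_of_le hr ?_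
    nlinarith
  · rw [div_le_iff₀ hr]
    refine le_of_sq_le_sq ?_ (by positivity)
    rw [mul_pow, hsq]
    nlinarith

theorem integral_cosh_sub (τ : ℝ) : ∫ x in 0..τ, cosh (τ - x) = sinh τ := by
  rw [intervalIntegral.integral_comp_sub_left (fun x => cosh x), sub_self, sub_zero,
    intervalIntegral.integral_eq_sub_of_hasDerivAt (fun x _ => hasDerivAt_sinh x)
      (continuous_cosh.intervalIntegrable _ _), sinh_zero, sub_zero]

theorem integral_cosh_sub_mul_sinh_sub (τ : ℝ) :
    ∫ x in 0..τ, cosh (τ - x) * sinh (τ - x) = sinh τ ^ 2 / 2 := by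
  have hderiv : ∀ x ∈ uIcc 0 τ, HasDerivAt (fun x => sinh x ^ 2 / 2) (cosh x * sinh x) x := by
    intro x _
    refine (((hasDerivAt_sinh x).fun_pow 2).div_const 2).congr_deriv ?_
    push_cast
    ring
  rw [intervalIntegral.integral_comp_sub_left (fun x => cosh x * sinh x), sub_self, sub_zero,
    intervalIntegral.integral_eq_sub_of_hasDerivAt hderiv
      ((continuous_cosh.mul continuous_sinh).intervalIntegrable _ _), sinh_zero]
  ring

theorem weight_sub_weight {τ e e' x : ℝ} (hd : 1 - e / cosh τ ^ 2 ≠ 0)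
    (hd' : 1 - e' / cosh τ ^ 2 ≠ 0) :
    weight τ e' x - weight τ e x =
      (e' - e) * ((cosh (τ - x) / cosh τ) ^ 2 + (1 / cosh τ) ^ 2) /
        ((1 - e / cosh τ ^ 2) * (1 - e' / cosh τ ^ 2)) := by
  unfold weight
  rw [div_sub_div _ _ hd' hd, mul_comm (1 - e' / cosh τ ^ 2)]
  congr 1
  · ring
  · ring

theorem weightedTime_sub_parameter {C τ e e' : ℝ} (hC : 1 ≤ C) (he : 1 ≤ C * (1 + e))
    (hee' : e ≤ e') (he' : 1 + e' ≤ C) (hτ0 : 0 ≤ τ) (hτ : 2 * C ≤ cosh τ ^ 2) :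
    (e' - e) / (72 * C ^ 2) ≤ weightedTime τ e - weightedTime τ e' ∧
      weightedTime τ e - weightedTime τ e' ≤ 32 * C ^ 2 * (e' - e) := by
  have he1 : 1 + e ≤ C := by linarith
  have he1' : 1 ≤ C * (1 + e') := by nlinarith
  have hc := cosh_pos τ
  have hd := one_sub_div_cosh_sq_mem hC he he1 hτ
  have hd' := one_sub_div_cosh_sq_mem hC he1' he' hτ
  have hdd : 1 / 4 ≤ (1 - e / cosh τ ^ 2) * (1 - e' / cosh τ ^ 2) := by nlinarith
  have hdd' : (1 - e / cosh τ ^ 2) * (1 - e' / cosh τ ^ 2) ≤ 9 / 4 := by nlinarith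
  have hi := intervalIntegrable_inv_sqrt_weight hC he he1 hτ le_rfl hτ0 le_rfl
  have hi' := intervalIntegrable_inv_sqrt_weight hC he1' he' hτ le_rfl hτ0 le_rfl
  have hcx : Continuous fun x => cosh (τ - x) := continuous_cosh.comp (by fun_prop)
  have hsx : Continuous fun x => sinh (τ - x) := continuous_sinh.comp (by fun_prop)
  have hsub := fun x => weight_sub_weight (τ := τ) (e := e) (e' := e') (x := x)
    (by linarith [hd.1]) (by linarith [hd'.1])
  rw [weightedTime, weightedTime, ← intervalIntegral.integral_sub hi hi']
  constructor
  · have hbound : ∀ x ∈ Icc 0 τ, (e' - e) / (18 * C ^ 2 * cosh τ ^ 2) *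
        (cosh (τ - x) * sinh (τ - x)) ≤ 1 / √(weight τ e x) - 1 / √(weight τ e' x) := by
      intro x hx
      have hw := weight_mem hC he he1 hτ hx
      have hw' := weight_mem hC he1' he' hτ hx
      have hsc : cosh (τ - x) * sinh (τ - x) ≤ cosh (τ - x) ^ 2 := by
        rw [sq]
        exact mul_le_mul_of_nonneg_left (sinh_lt_cosh _).le (cosh_pos _).le
      have hlow : (e' - e) * (cosh (τ - x) / cosh τ) ^ 2 * (4 / 9) ≤
          weight τ e' x - weight τ e x := by
        rw [hsub, le_div_iff₀ (by linarith)]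
        have hz := mul_nonneg (sub_nonneg.2 hee') (sq_nonneg (cosh (τ - x) / cosh τ))
        have hz' := mul_nonneg (sub_nonneg.2 hee') (sq_nonneg (1 / cosh τ))
        nlinarith
      have hnn : 0 ≤ (e' - e) * (cosh (τ - x) / cosh τ) ^ 2 * (4 / 9) := by
        have := sub_nonneg.2 hee'
        positivity
      refine le_trans ?_ (le_inv_sqrt_sub (s := 2 * C) (by linarith) ?_ (by linarith) hw'.2)
      · rw [le_div_iff₀ (by positivity)]
        refine le_trans ?_ hlow
        calc (e' - e) / (18 * C ^ 2 * cosh τ ^ 2) * (cosh (τ - x) * sinh (τ - x)) *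
              (2 * (2 * C) ^ 2)
            ≤ (e' - e) / (18 * C ^ 2 * cosh τ ^ 2) * cosh (τ - x) ^ 2 * (2 * (2 * C) ^ 2) := by
              have := sub_nonneg.2 hee'
              gcongr
          _ = _ := by field_simp; ring
      · by_contra! h
        nlinarith
    have hval : ∫ x in 0..τ, (e' - e) / (18 * C ^ 2 * cosh τ ^ 2) *
        (cosh (τ - x) * sinh (τ - x)) =
        (e' - e) / (18 * C ^ 2 * cosh τ ^ 2) * (sinh τ ^ 2 / 2) := by
      rw [intervalIntegral.integral_const_mul, integral_cosh_sub_mul_sinh_sub]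
    refine le_trans ?_ (intervalIntegral.integral_mono_on hτ0
      (Continuous.intervalIntegrable (by fun_prop) _ _) (hi.sub hi') hbound)
    rw [hval, sinh_sq, div_mul_eq_mul_div, div_le_div_iff₀ (by positivity) (by positivity)]
    have := sub_nonneg.2 hee'
    have h2 : 2 ≤ cosh τ ^ 2 := by linarith
    have : 0 ≤ (e' - e) * C ^ 2 * (cosh τ ^ 2 - 2) := mul_nonneg (by positivity) (by linarith)
    nlinarith
  · have hbound : ∀ x ∈ Icc 0 τ, 1 / √(weight τ e x) - 1 / √(weight τ e' x) ≤
        32 * C ^ 2 * (e' - e) / cosh τ * cosh (τ - x) := by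
      intro x hx
      have hw := weight_mem hC he he1 hτ hx
      have hw' := weight_mem hC he1' he' hτ hx
      have hz := cosh_ratio_mem hx
      set z := cosh (τ - x) / cosh τ with hzdef
      have hz0 : 0 < 1 / cosh τ := by positivity
      have hup : |weight τ e x - weight τ e' x| ≤ 8 * (e' - e) * z := by
        have hsum : z ^ 2 + (1 / cosh τ) ^ 2 ≤ 2 * z := by nlinarith
        have hpos := mul_nonneg (sub_nonneg.2 hee')
          (add_nonneg (sq_nonneg z) (sq_nonneg (1 / cosh τ)))
        have h1 := mul_le_mul_of_nonneg_left hsum (sub_nonneg.2 hee')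
        rw [abs_sub_comm, hsub, abs_of_nonneg (div_nonneg hpos (by linarith)),
          div_le_iff₀ (by linarith)]
        have h2 : 0 ≤ 8 * (e' - e) * z := by
          have := sub_nonneg.2 hee'
          have : 0 ≤ z := by linarith
          positivity
        nlinarith
      calc 1 / √(weight τ e x) - 1 / √(weight τ e' x)
          ≤ |1 / √(weight τ e x) - 1 / √(weight τ e' x)| := le_abs_self _
        _ ≤ (2 * C) ^ 2 * |weight τ e x - weight τ e' x| :=
            abs_inv_sqrt_sub_le (by linarith) hw.1 hw'.1
        _ ≤ (2 * C) ^ 2 * (8 * (e' - e) * z) := by gcongr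
        _ = _ := by rw [hzdef]; ring
    refine (intervalIntegral.integral_mono_on hτ0 (hi.sub hi')
      (Continuous.intervalIntegrable (by fun_prop) _ _) hbound).trans ?_
    rw [intervalIntegral.integral_const_mul, integral_cosh_sub, div_mul_eq_mul_div,
      div_le_iff₀ hc]
    exact mul_le_mul_of_nonneg_left (sinh_lt_cosh τ).le
      (mul_nonneg (by positivity) (sub_nonneg.2 hee'))

theorem cosh_le_exp_mul_cosh {a b : ℝ} (hab : a ≤ b) : cosh b ≤ exp (b - a) * cosh a := by
  have h : cosh b = cosh (b - a) * cosh a + sinh (b - a) * sinh a := by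
    rw [← cosh_add]; congr 1; ring
  have hs : 0 ≤ sinh (b - a) := sinh_nonneg_iff.2 (by linarith)
  rw [h, ← cosh_add_sinh, add_mul]
  have := mul_le_mul_of_nonneg_left (sinh_lt_cosh a).le hs
  linarith

theorem sinh_le_two_mul_mul_cosh {h : ℝ} (hh : 0 ≤ h) : sinh h ≤ 2 * h * cosh h := by
  rw [sinh_eq, cosh_eq]
  have h1 : 1 - 2 * h ≤ exp (-(2 * h)) := one_sub_le_exp_neg _
  have h2 : exp (-(2 * h)) * exp h = exp (-h) := by rw [← exp_add]; congr 1; ring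
  have h3 := exp_pos h
  have h4 := exp_pos (-h)
  have h5 := mul_le_mul_of_nonneg_right h1 h3.le
  rw [h2] at h5
  have h6 := mul_nonneg hh h4.le
  nlinarith

theorem cosh_ratio_sub {σ τ x : ℝ} :
    cosh (σ - x) / cosh σ - cosh (τ - x) / cosh τ =
      sinh (τ - σ) * sinh x / (cosh τ * cosh σ) := by
  have h1 := (cosh_pos σ).ne'
  have h2 := (cosh_pos τ).ne'
  rw [div_sub_div _ _ h1 h2, mul_comm (cosh τ) (cosh σ)]
  congr 1
  rw [cosh_sub, cosh_sub, sinh_sub]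
  ring

theorem cosh_ratio_sub_le {σ τ x : ℝ} (hστ : σ ≤ τ) (hx : x ∈ Icc 0 σ) :
    0 ≤ cosh (σ - x) / cosh σ - cosh (τ - x) / cosh τ ∧
      cosh (σ - x) / cosh σ - cosh (τ - x) / cosh τ ≤ 2 * (τ - σ) / cosh σ := by
  have hσ := cosh_pos σ
  have hτ := cosh_pos τ
  have hσ0 : 0 ≤ σ := hx.1.trans hx.2
  have hs : 0 ≤ sinh (τ - σ) := sinh_nonneg_iff.2 (by linarith)
  have hsx : 0 ≤ sinh x := sinh_nonneg_iff.2 hx.1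
  rw [cosh_ratio_sub]
  refine ⟨by positivity, ?_⟩
  have h1 : cosh (τ - σ) * cosh σ ≤ cosh τ := by
    have h : cosh τ = cosh (τ - σ) * cosh σ + sinh (τ - σ) * sinh σ := by
      rw [← cosh_add]; congr 1; ring
    have := mul_nonneg hs (sinh_nonneg_iff.2 hσ0)
    linarith
  have h2 : sinh x ≤ cosh σ := by
    refine (sinh_le_sinh.2 hx.2).trans (sinh_lt_cosh σ).le
  rw [div_le_div_iff₀ (by positivity) hσ]
  have h3 := sinh_le_two_mul_mul_cosh (sub_nonneg.2 hστ)
  calc sinh (τ - σ) * sinh x * cosh σ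
      ≤ (2 * (τ - σ) * cosh (τ - σ)) * cosh σ * cosh σ := by gcongr
    _ = 2 * (τ - σ) * (cosh (τ - σ) * cosh σ) * cosh σ := by ring
    _ ≤ 2 * (τ - σ) * cosh τ * cosh σ := by
        have := sub_nonneg.2 hστ
        gcongr
    _ = _ := by ring

theorem inv_cosh_sq_sub_le {σ τ : ℝ} (hσ0 : 0 ≤ σ) (hστ : σ ≤ τ) :
    0 ≤ 1 / cosh σ ^ 2 - 1 / cosh τ ^ 2 ∧
      1 / cosh σ ^ 2 - 1 / cosh τ ^ 2 ≤ 2 * (τ - σ) / cosh σ := by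
  have hσ := cosh_pos σ
  have hτ := cosh_pos τ
  have hmono : cosh σ ≤ cosh τ := by
    rw [cosh_le_cosh, abs_of_nonneg hσ0, abs_of_nonneg (hσ0.trans hστ)]
    exact hστ
  have hinv : 1 / cosh τ ≤ 1 / cosh σ := one_div_le_one_div_of_le hσ hmono
  have h1 : 1 / cosh σ ≤ 1 := by rw [div_le_one hσ]; exact one_le_cosh σ
  have h0 : 0 < 1 / cosh τ := by positivity
  have hdiff : 1 / cosh σ - 1 / cosh τ ≤ (τ - σ) / cosh σ := by
    rw [div_sub_div _ _ hσ.ne' hτ.ne', div_le_div_iff₀ (by positivity) hσ]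
    have h := cosh_le_exp_mul_cosh hστ
    have he : 1 - (τ - σ) ≤ exp (-(τ - σ)) := one_sub_le_exp_neg _
    have h2 : cosh τ * exp (-(τ - σ)) ≤ cosh σ := by
      rw [exp_neg, ← div_eq_mul_inv, div_le_iff₀ (exp_pos _)]
      linarith
    have h3 := mul_le_mul_of_nonneg_left he hτ.le
    have h4 : 0 ≤ cosh σ * (cosh σ - cosh τ * (1 - (τ - σ))) :=
      mul_nonneg hσ.le (by linarith)
    nlinarith
  have hfac : 1 / cosh σ ^ 2 - 1 / cosh τ ^ 2 =
      (1 / cosh σ - 1 / cosh τ) * (1 / cosh σ + 1 / cosh τ) := by ring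
  rw [hfac]
  refine ⟨mul_nonneg (by linarith) (by linarith), ?_⟩
  calc (1 / cosh σ - 1 / cosh τ) * (1 / cosh σ + 1 / cosh τ)
      ≤ ((τ - σ) / cosh σ) * 2 := by
        refine mul_le_mul hdiff (by linarith) (by linarith) ?_
        have := sub_nonneg.2 hστ
        positivity
    _ = _ := by ring

theorem abs_weight_sub_time_le {C σ τ e x : ℝ} (hC : 1 ≤ C) (he : 1 ≤ C * (1 + e))
    (he' : 1 + e ≤ C) (hσ : 2 * C ≤ cosh σ ^ 2) (hτ : 2 * C ≤ cosh τ ^ 2) (hστ : σ ≤ τ)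
    (hx : x ∈ Icc 0 σ) :
    |weight τ e x - weight σ e x| ≤ 32 * C ^ 2 * ((τ - σ) / cosh σ) := by
  have hσ0 : 0 ≤ σ := hx.1.trans hx.2
  have hz := cosh_ratio_sub_le hστ hx
  have hS := inv_cosh_sq_sub_le hσ0 hστ
  have hzτ := cosh_ratio_mem (τ := τ) ⟨hx.1, hx.2.trans hστ⟩
  have hzσ := cosh_ratio_mem hx
  have hd := one_sub_div_cosh_sq_mem hC he he' hτ
  have hd' := one_sub_div_cosh_sq_mem hC he he' hσ
  have hzτ0 : 0 ≤ cosh (τ - x) / cosh τ := div_nonneg (cosh_pos _).le (cosh_pos _).le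
  have hzσ0 : 0 ≤ cosh (σ - x) / cosh σ := div_nonneg (cosh_pos _).le (cosh_pos _).le
  have hn' := one_add_mul_sq_mem hC he he' hzσ0 hzσ.2
  have habs : |e| ≤ C := abs_le.2 ⟨by nlinarith, by linarith⟩
  have hδ : 0 ≤ (τ - σ) / cosh σ := div_nonneg (by linarith) (cosh_pos _).le
  unfold weight
  rw [div_eq_mul_one_div e (cosh τ ^ 2)] at hd ⊢
  rw [div_eq_mul_one_div e (cosh σ ^ 2)] at hd' ⊢
  rw [mul_div_assoc] at hz hS
  set δ := (τ - σ) / cosh σ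
  set z := cosh (τ - x) / cosh τ
  set y := cosh (σ - x) / cosh σ
  set S := 1 / cosh τ ^ 2
  set R := 1 / cosh σ ^ 2
  have hnum : |(1 + e * z ^ 2) - (1 + e * y ^ 2)| ≤ 4 * C * δ := by
    have : (1 + e * z ^ 2) - (1 + e * y ^ 2) = -(e * ((y - z) * (y + z))) := by ring
    rw [this, abs_neg, abs_mul, abs_mul, abs_of_nonneg hz.1, abs_of_nonneg (by linarith : 0 ≤ y + z)]
    calc |e| * ((y - z) * (y + z)) ≤ C * ((2 * δ) * 2) := by
          gcongr
          · exact mul_nonneg hz.1 (by linarith)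
          · exact hz.2
          · linarith
      _ = _ := by ring
  have hden : |(1 - e * R) - (1 - e * S)| ≤ 2 * C * δ := by
    have : (1 - e * R) - (1 - e * S) = -(e * (R - S)) := by ring
    rw [this, abs_neg, abs_mul, abs_of_nonneg hS.1]
    calc |e| * (R - S) ≤ C * (2 * δ) := by
          gcongr
          · exact hS.1
          · exact hS.2
      _ = _ := by ring
  have hn0 : 0 ≤ 1 + e * y ^ 2 := by by_contra! h; nlinarith
  have hdd : 1 / 4 ≤ (1 - e * S) * (1 - e * R) := by nlinarith
  rw [div_sub_div _ _ (by linarith) (by linarith), abs_div,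
    abs_of_pos (by linarith : 0 < (1 - e * S) * (1 - e * R)), div_le_iff₀ (by linarith)]
  have hsplit : (1 + e * z ^ 2) * (1 - e * R) - (1 - e * S) * (1 + e * y ^ 2) =
      ((1 + e * z ^ 2) - (1 + e * y ^ 2)) * (1 - e * R) +
        (1 + e * y ^ 2) * ((1 - e * R) - (1 - e * S)) := by ring
  rw [hsplit]
  calc _ ≤ |((1 + e * z ^ 2) - (1 + e * y ^ 2)) * (1 - e * R)| +
        |(1 + e * y ^ 2) * ((1 - e * R) - (1 - e * S))| := abs_add_le _ _
    _ ≤ 4 * C * δ * (3 / 2) + C * (2 * C * δ) := by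
        rw [abs_mul, abs_mul, abs_of_nonneg hn0, abs_of_nonneg (by linarith : 0 ≤ 1 - e * R)]
        gcongr
        · linarith
        · exact hd'.2
        · exact hn'.2
    _ ≤ 8 * C ^ 2 * δ := by nlinarith [mul_nonneg (sub_nonneg.2 hC) hδ, mul_nonneg (mul_nonneg (sub_nonneg.2 hC) hδ) (by linarith : 0 ≤ C)]
    _ ≤ _ := by nlinarith [mul_nonneg (sq_nonneg C) hδ]

theorem two_mul_le_cosh_sq {C τ : ℝ} (hC : 1 ≤ C) (hτ : 2000 * C ^ 5 ≤ τ) :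
    2 * C ≤ cosh τ ^ 2 := by
  have hC5 : C ≤ C ^ 5 := le_self_pow₀ hC (by norm_num)
  have h1 : τ ≤ cosh τ := le_cosh_of_nonneg (by linarith)
  nlinarith [one_le_cosh τ]

theorem weightedTime_sub_time {C σ τ e : ℝ} (hC : 1 ≤ C) (he : 1 ≤ C * (1 + e))
    (he' : 1 + e ≤ C) (hσ : 2000 * C ^ 5 ≤ σ) (hστ : σ ≤ τ) :
    (τ - σ) / (4 * C) ≤ weightedTime τ e - weightedTime σ e ∧
      weightedTime τ e - weightedTime σ e ≤ 3 * C * (τ - σ) := by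
  have hC5 : 1 ≤ C ^ 5 := one_le_pow₀ hC
  have hσ0 : 0 < σ := by linarith
  have hcσ := two_mul_le_cosh_sq hC hσ
  have hcτ := two_mul_le_cosh_sq hC (hσ.trans hστ)
  have hh := sub_nonneg.2 hστ
  have hi1 := intervalIntegrable_inv_sqrt_weight hC he he' hcτ le_rfl hσ0.le hστ
  have hi2 := intervalIntegrable_inv_sqrt_weight hC he he' hcτ hσ0.le hστ le_rfl
  have hi3 := intervalIntegrable_inv_sqrt_weight hC he he' hcσ le_rfl hσ0.le le_rfl
  have hsplit : weightedTime τ e - weightedTime σ e =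
      (∫ x in 0..σ, (1 / √(weight τ e x) - 1 / √(weight σ e x))) +
        ∫ x in σ..τ, 1 / √(weight τ e x) := by
    rw [intervalIntegral.integral_sub hi1 hi3, weightedTime, weightedTime,
      ← intervalIntegral.integral_add_adjacent_intervals hi1 hi2]
    ring
  have hsmall : |∫ x in 0..σ, (1 / √(weight τ e x) - 1 / √(weight σ e x))| ≤
      (τ - σ) / (4 * C) := by
    have hbound : ∀ x ∈ uIoc 0 σ, ‖1 / √(weight τ e x) - 1 / √(weight σ e x)‖ ≤
        128 * C ^ 4 * ((τ - σ) / cosh σ) := by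
      intro x hx
      rw [uIoc_of_le hσ0.le] at hx
      have hx' : x ∈ Icc 0 σ := ⟨hx.1.le, hx.2⟩
      calc ‖1 / √(weight τ e x) - 1 / √(weight σ e x)‖
          ≤ (2 * C) ^ 2 * |weight τ e x - weight σ e x| :=
            abs_inv_sqrt_sub_le (by linarith)
              (weight_mem hC he he' hcτ ⟨hx'.1, hx'.2.trans hστ⟩).1
              (weight_mem hC he he' hcσ hx').1
        _ ≤ (2 * C) ^ 2 * (32 * C ^ 2 * ((τ - σ) / cosh σ)) := by
            gcongr
            exact abs_weight_sub_time_le hC he he' hcσ hcτ hστ hx'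
        _ = _ := by ring
    have h := intervalIntegral.norm_integral_le_of_norm_le_const hbound
    rw [sub_zero, abs_of_pos hσ0] at h
    refine h.trans ?_
    have hcosh := add_sq_half_le_cosh σ hσ0.le
    have hc := cosh_pos σ
    have hkey : 512 * C ^ 5 * σ ≤ cosh σ := by nlinarith
    rw [← mul_div_assoc, div_mul_eq_mul_div, div_le_div_iff₀ hc (by positivity)]
    calc 128 * C ^ 4 * (τ - σ) * σ * (4 * C) = (τ - σ) * (512 * C ^ 5 * σ) := by ring
      _ ≤ _ := by gcongr
  have hmem : ∀ x ∈ Icc σ τ, 1 / (2 * C) ≤ 1 / √(weight τ e x) ∧ 1 / √(weight τ e x) ≤ 2 * C := by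
    intro x hx
    have := weight_mem hC he he' hcτ ⟨hσ0.le.trans hx.1, hx.2⟩
    exact inv_sqrt_mem (by linarith) this.1 this.2
  have hlow := intervalIntegral.integral_mono_on hστ (intervalIntegrable_const) hi2
    fun x hx => (hmem x hx).1
  have hupp := intervalIntegral.integral_mono_on hστ hi2 (intervalIntegrable_const)
    fun x hx => (hmem x hx).2
  rw [intervalIntegral.integral_const, smul_eq_mul] at hlow hupp
  obtain ⟨hs1, hs2⟩ := abs_le.1 hsmall
  have h1 : (τ - σ) * (1 / (2 * C)) = 2 * ((τ - σ) / (4 * C)) := by field_simp; norm_num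
  have h2 : (τ - σ) / (4 * C) ≤ (τ - σ) * C := by
    rw [div_le_iff₀ (by positivity)]
    nlinarith [mul_nonneg hh (by nlinarith : 0 ≤ C * C * 4 - 1)]
  rw [hsplit]
  constructor <;> linarith

theorem cosh_sq_sub_cosh_sq {σ τ : ℝ} :
    cosh τ ^ 2 - cosh σ ^ 2 = sinh (τ + σ) * sinh (τ - σ) := by
  rw [sinh_add, sinh_sub]
  linear_combination (cosh σ ^ 2) * cosh_sq τ - (cosh τ ^ 2) * cosh_sq σ

theorem parameter_lt_of_weightedTime_le {C p p' e e' τ τ' : ℝ} (hC : 1 ≤ C)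
    (he : 1 ≤ C * (1 + e)) (heC : 1 + e ≤ C) (heC' : 1 + e' ≤ C)
    (hp : 0 < p) (hpp' : p < p') (hτ : 2000 * C ^ 5 ≤ τ) (hτ' : 2000 * C ^ 5 ≤ τ')
    (h : cosh τ ^ 2 = 1 / p ^ 2 + e) (h' : cosh τ' ^ 2 = 1 / p' ^ 2 + e')
    (hT : weightedTime τ e ≤ weightedTime τ' e') : e' < e := by
  by_contra! hee'
  have hC0 : 0 < C := by linarith
  have hinv : 1 / p' ^ 2 < 1 / p ^ 2 := by gcongr
  have hC5 : C ^ 3 ≤ C ^ 5 := pow_le_pow_right₀ hC (by norm_num)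
  have hC3 : 1 ≤ C ^ 3 := one_le_pow₀ hC
  have hcτ := two_mul_le_cosh_sq hC hτ
  have hcτ' := two_mul_le_cosh_sq hC hτ'
  have hpar := (weightedTime_sub_parameter hC he hee' heC' (by linarith) hcτ').1
  rcases le_total τ' τ with hττ' | hττ'
  · have ht := (weightedTime_sub_time hC he heC hτ' hττ').1
    have h1 : 0 ≤ (τ - τ') / (4 * C) := div_nonneg (by linarith) (by linarith)
    have h2 : 0 ≤ (e' - e) / (72 * C ^ 2) := div_nonneg (by linarith) (by positivity)
    have h3 : (e' - e) / (72 * C ^ 2) = 0 := by linarith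
    have h4 : (τ - τ') / (4 * C) = 0 := by linarith
    rw [div_eq_zero_iff] at h3 h4
    have h5 : e' = e := by
      rcases h3 with h3 | h3
      · linarith
      · exact absurd h3 (by positivity)
    have h6 : τ = τ' := by
      rcases h4 with h4 | h4
      · linarith
      · exact absurd h4 (by positivity)
    rw [h6] at h
    linarith
  · have ht := (weightedTime_sub_time hC he heC hτ hττ').2
    have h0 : 0 ≤ τ' - τ := by linarith
    have hs1 : τ' + τ ≤ sinh (τ' + τ) := self_le_sinh_iff.2 (by linarith)
    have hs2 : τ' - τ ≤ sinh (τ' - τ) := self_le_sinh_iff.2 h0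
    have hs := mul_le_mul hs1 hs2 h0 (by linarith)
    rw [← cosh_sq_sub_cosh_sq, h, h'] at hs
    have h1 : 4000 * C ^ 3 * (τ' - τ) ≤ (τ' + τ) * (τ' - τ) :=
      mul_le_mul_of_nonneg_right (by linarith) h0
    have h2 : 4000 * C ^ 3 * (τ' - τ) < e' - e := by linarith
    have h3 : 3 * C * (τ' - τ) < (e' - e) / (72 * C ^ 2) := by
      rw [lt_div_iff₀ (by positivity)]
      have := mul_nonneg (by positivity : 0 ≤ C ^ 3) h0
      nlinarith
    linarith [(weightedTime_sub_parameter hC he hee' heC' (by linarith) hcτ').1]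

theorem log_div_le_parameter_sub {C p p' e e' τ τ' : ℝ} (hC : 1 ≤ C)
    (he : 1 ≤ C * (1 + e)) (heC : 1 + e ≤ C) (he' : 1 ≤ C * (1 + e')) (heC' : 1 + e' ≤ C)
    (hp : 0 < p) (hpp' : p < p') (hτ : 2000 * C ^ 5 ≤ τ) (hτ' : 2000 * C ^ 5 ≤ τ')
    (h : cosh τ ^ 2 = 1 / p ^ 2 + e) (h' : cosh τ' ^ 2 = 1 / p' ^ 2 + e')
    (hT : weightedTime τ e ≤ weightedTime τ' e') :
    log (p' / p) ≤ 256 * C ^ 3 * (e - e') := by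
  have hC0 : 0 < C := by linarith
  have hp' : 0 < p' := hp.trans hpp'
  have hee' := parameter_lt_of_weightedTime_le hC he heC heC' hp hpp' hτ hτ' h h' hT
  have hcτ' := two_mul_le_cosh_sq hC hτ'
  have hC5 : 1 ≤ C ^ 5 := one_le_pow₀ hC
  have hinv : 1 / p' ^ 2 < 1 / p ^ 2 := by gcongr
  have hττ' : τ' ≤ τ := by
    have : cosh τ' ^ 2 ≤ cosh τ ^ 2 := by linarith
    have := (sq_le_sq₀ (cosh_pos _).le (cosh_pos _).le).1 this
    rwa [cosh_le_cosh, abs_of_nonneg (by linarith), abs_of_nonneg (by linarith)] at this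
  have hpar := (weightedTime_sub_parameter hC he' hee'.le heC (by linarith) hcτ').2
  have ht := (weightedTime_sub_time hC he heC hτ' hττ').1
  have hratio : p' / p * cosh τ' ^ 2 ≤ cosh τ ^ 2 := by
    have hx : 1 ≤ 1 / p' ^ 2 := by linarith
    have hep : e' ≤ 1 / p' * (1 / p) := by
      have h1 : 1 / p' ^ 2 ≤ 1 / p' * (1 / p) := by
        rw [pow_two, ← one_div_mul_one_div]
        gcongr
      linarith
    have hd : 0 ≤ (p' / p - 1) * (1 / p' * (1 / p) - e') := by
      refine mul_nonneg ?_ (by linarith)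
      rw [sub_nonneg, one_le_div hp]
      exact hpp'.le
    have hid : (p' / p - 1) * (1 / p' * (1 / p) - e') =
        1 / p ^ 2 + e' - p' / p * (1 / p' ^ 2 + e') := by
      field_simp
      ring
    rw [h, h']
    linarith
  have hexp : p' / p ≤ exp (2 * (τ - τ')) := by
    have h1 := pow_le_pow_left₀ (cosh_pos τ).le (cosh_le_exp_mul_cosh hττ') 2
    rw [mul_pow, ← exp_nat_mul] at h1
    push_cast at h1
    have hc : 0 < cosh τ' ^ 2 := pow_pos (cosh_pos _) 2
    exact le_of_mul_le_mul_right (hratio.trans h1) hc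
  have hlog : log (p' / p) ≤ 2 * (τ - τ') := (log_le_iff_le_exp (div_pos hp' hp)).2 hexp
  have hfin : (τ - τ') / (4 * C) ≤ 32 * C ^ 2 * (e - e') := by linarith
  rw [div_le_iff₀ (by positivity)] at hfin
  nlinarith

theorem sq_sub_sq_le_log_div {p p' : ℝ} (hp : 0 < p) (hpp' : p ≤ p') :
    p' ^ 2 - p ^ 2 ≤ 2 * p' ^ 2 * log (p' / p) := by
  have hp' : 0 < p' := hp.trans_le hpp'
  have h := one_sub_inv_le_log_of_pos (div_pos hp' hp)
  rw [inv_div] at h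
  have h1 : p' ^ 2 * (1 - p / p') = p' * (p' - p) := by field_simp
  have h2 := mul_le_mul_of_nonneg_left h (sq_nonneg p')
  nlinarith

theorem log_div_le_amplitude_sub {C p p' e e' : ℝ} (hC : 1 ≤ C)
    (he : 1 ≤ C * (1 + e)) (he' : 1 ≤ C * (1 + e')) (heC' : 1 + e' ≤ C)
    (hp : 0 < p) (hpp' : p < p') (hp'C : 8192 * C ^ 5 * p' ^ 2 ≤ 1)
    (h : log (p' / p) ≤ 256 * C ^ 3 * (e - e')) :
    log (p' / p) ≤ 1024 * C ^ 3 * ((1 + e) * (1 + e * (p ^ 2 / (1 - p ^ 2))) -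
      (1 + e') * (1 + e' * (p' ^ 2 / (1 - p' ^ 2)))) := by
  have hp' : 0 < p' := hp.trans hpp'
  have hC5 : 1 ≤ C ^ 5 := one_le_pow₀ hC
  have hC3 : 1 ≤ C ^ 3 := one_le_pow₀ hC
  have hX : 0 < log (p' / p) := log_pos ((one_lt_div hp).2 hpp')
  have hsq := sq_sub_sq_le_log_div hp hpp'.le
  set X := log (p' / p)
  have hp'2 : p' ^ 2 ≤ 1 / 4 := by nlinarith [sq_nonneg p']
  have hlt : p ^ 2 < p' ^ 2 := by gcongr
  have hee' : 0 < e - e' := by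
    by_contra! hn
    have := mul_nonneg (by linarith : 0 ≤ 256 * C ^ 3) (neg_nonneg.2 hn)
    linarith
  have h1e : 0 < 1 + e := by by_contra! hn; nlinarith
  have h1e' : 0 < 1 + e' := by by_contra! hn; nlinarith
  have hd : (1 : ℝ) / 2 ≤ (1 - p ^ 2) * (1 - p' ^ 2) := by nlinarith [sq_nonneg p]
  have hω : p ^ 2 / (1 - p ^ 2) ≤ 1 / 2 := by
    rw [div_le_iff₀ (by linarith)]
    linarith
  have hω0 : 0 ≤ p ^ 2 / (1 - p ^ 2) := div_nonneg (sq_nonneg p) (by linarith)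
  have hωω' : p' ^ 2 / (1 - p' ^ 2) - p ^ 2 / (1 - p ^ 2) =
      (p' ^ 2 - p ^ 2) / ((1 - p ^ 2) * (1 - p' ^ 2)) := by
    rw [div_sub_div _ _ (by linarith) (by linarith)]
    congr 1 <;> ring
  have hdiff0 : 0 ≤ p' ^ 2 / (1 - p' ^ 2) - p ^ 2 / (1 - p ^ 2) := by
    rw [hωω']
    exact div_nonneg (by linarith) (by linarith)
  have hdiff : p' ^ 2 / (1 - p' ^ 2) - p ^ 2 / (1 - p ^ 2) ≤ 4 * p' ^ 2 * X := by
    rw [hωω', div_le_iff₀ (by linarith)]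
    have : 0 ≤ p' ^ 2 * X := by positivity
    nlinarith
  set ω := p ^ 2 / (1 - p ^ 2)
  set ω' := p' ^ 2 / (1 - p' ^ 2)
  have hsplit : (1 + e) * (1 + e * ω) - (1 + e') * (1 + e' * ω') =
      (e - e') * (1 + ω * (1 + e + e')) - (1 + e') * e' * (ω' - ω) := by ring
  have h1 : (e - e') / 2 ≤ (e - e') * (1 + ω * (1 + e + e')) := by
    have : 1 / 2 ≤ 1 + ω * (1 + e + e') := by nlinarith
    nlinarith
  have h2 : (1 + e') * e' * (ω' - ω) ≤ C ^ 2 * (4 * p' ^ 2 * X) := by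
    have : (1 + e') * e' ≤ C ^ 2 := by nlinarith
    calc (1 + e') * e' * (ω' - ω) ≤ C ^ 2 * (ω' - ω) := by gcongr
      _ ≤ _ := by gcongr
  have h3 : 8192 * C ^ 5 * p' ^ 2 * X ≤ X := by nlinarith
  rw [hsplit]
  have h4 : 1024 * C ^ 3 * ((e - e') / 2 - C ^ 2 * (4 * p' ^ 2 * X)) ≤
      1024 * C ^ 3 * ((e - e') * (1 + ω * (1 + e + e')) - (1 + e') * e' * (ω' - ω)) := by
    gcongr
  have h5 : 1024 * C ^ 3 * ((e - e') / 2 - C ^ 2 * (4 * p' ^ 2 * X)) =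
      2 * (256 * C ^ 3 * (e - e')) - (8192 * C ^ 5 * p' ^ 2 * X) / 2 := by ring
  linarith

theorem le_sq_sub_sq_of_linear_relation {D K M X α α' β β' : ℝ} (hD : 0 ≤ D) (hX : 0 < X)
    (hK : 1 ≤ K) (hM : 1 ≤ M) (hβ : 1 / 2 ≤ β) (hβ' : 1 / 2 ≤ β') (hβ1 : β ≤ 1) (hβ1' : β' ≤ 1)
    (h : 2 * K * α - 2 * M * β = 1) (h' : 2 * K * α' - 2 * M * β' = 1)
    (hα : X ≤ D * (α ^ 2 - α' ^ 2)) :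
    X ≤ 2 * (K + M) ^ 2 * D * (β ^ 2 - β' ^ 2) := by
  have hα1 : α ≤ K + M := by nlinarith
  have hα1' : α' ≤ K + M := by nlinarith
  have hα0 : 0 < α := by by_contra! hn; nlinarith
  have hα0' : 0 < α' := by by_contra! hn; nlinarith
  have hlt : 0 < α - α' := by
    by_contra! hn
    have : α ^ 2 - α' ^ 2 ≤ 0 := by nlinarith
    nlinarith
  have h1 : α ^ 2 - α' ^ 2 ≤ 2 * (K + M) * (α - α') := by nlinarith
  have h2 : K * (α - α') = M * (β - β') := by linarith
  have hββ' : 0 ≤ β - β' := by by_contra! hn; nlinarith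
  have h3 : α - α' ≤ (K + M) * (β - β') := by nlinarith
  have h4 : β - β' ≤ β ^ 2 - β' ^ 2 := by nlinarith
  calc X ≤ D * (α ^ 2 - α' ^ 2) := hα
    _ ≤ D * (2 * (K + M) * ((K + M) * (β ^ 2 - β' ^ 2))) := by
        refine mul_le_mul_of_nonneg_left (h1.trans ?_) hD
        refine mul_le_mul_of_nonneg_left (h3.trans ?_) (by linarith)
        exact mul_le_mul_of_nonneg_left h4 (by linarith)
    _ = _ := by ring

theorem one_half_le_of_cosh_le {p m t η : ℝ} (hm : 0 < m) (hmp : m < p) (hp : p ^ 2 ≤ 1 / 4)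
    (hη : cosh η = p / m) (ht : t ∈ Icc 0 η) : 1 / 2 ≤ 1 - m ^ 2 - m ^ 2 * cosh t ^ 2 := by
  have h1 : cosh t ≤ p / m := by
    rw [← hη, cosh_le_cosh, abs_of_nonneg ht.1, abs_of_nonneg (ht.1.trans ht.2)]
    exact ht.2
  have h2 : m * cosh t ≤ p := by rw [le_div_iff₀ hm] at h1; linarith
  have h3 : (m * cosh t) ^ 2 ≤ p ^ 2 := pow_le_pow_left₀ (mul_pos hm (cosh_pos t)).le h2 2
  have h4 : m ^ 2 ≤ p ^ 2 := by gcongr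
  nlinarith

theorem intervalIntegrable_inv_sqrt_cosh {m a b : ℝ} (hab : a ≤ b)
    (h : ∀ t ∈ Icc a b, 1 / 2 ≤ 1 - m ^ 2 - m ^ 2 * cosh t ^ 2) :
    IntervalIntegrable (fun t => 1 / √(1 - m ^ 2 - m ^ 2 * cosh t ^ 2)) volume a b := by
  refine ContinuousOn.intervalIntegrable ?_
  rw [uIcc_of_le hab]
  refine continuousOn_const.div ?_ fun t ht => (sqrt_pos.2 (by linarith [h t ht])).ne'
  have := continuous_cosh
  fun_prop

theorem log_add_log_of_A_eq {κ m p : ℝ} (hκ : 0 < κ) (hm : 0 < m) (hm1 : m ^ 2 < 1) (hp : 0 < p)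
    (hp1 : p ^ 2 < 1) (h : A m = κ * A p) :
    2 * log m + log (1 - m ^ 2) = log κ + 2 * log p + log (1 - p ^ 2) := by
  have h' := congrArg log h
  unfold A at h'
  rw [log_mul (by positivity) (by linarith), log_mul hκ.ne' (mul_pos (by positivity)
    (by linarith)).ne', log_mul (by positivity) (by linarith), log_pow, log_pow] at h'
  push_cast at h'
  linarith

theorem log_div_le_half_width_sub {D κ κ' m m' p p' η η' : ℝ} (hD : 1 ≤ D)
    (hκ : 0 < κ) (hκ' : 10 * D * κ' ≤ 1) (hm : 0 < m) (hmp : m < p) (hm' : 0 < m')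
    (hmp' : m' < p') (hpp' : p < p') (hp' : 32 * p' ^ 2 ≤ 1) (hη : 0 < η) (hη' : 0 < η')
    (hc : cosh η = p / m) (hc' : cosh η' = p' / m') (hA : A m = κ * A p) (hA' : A m' = κ' * A p')
    (h : log (p' / p) ≤ D * (κ' - κ)) :
    m < m' ∧ η' < η ∧ 4 * log (m' / m) ≤ 5 * (η - η') := by
  have hp : 0 < p := hm.trans hmp
  have hp0' : 0 < p' := hp.trans hpp'
  have hX : 0 < log (p' / p) := log_pos ((one_lt_div hp).2 hpp')
  have hsq := sq_sub_sq_le_log_div hp hpp'.le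
  have hXeq : log (p' / p) = log p' - log p := log_div hp0'.ne' hp.ne'
  set X := log (p' / p)
  have hppsq : p ^ 2 < p' ^ 2 := by gcongr
  have hmpsq : m ^ 2 < p ^ 2 := by gcongr
  have hmpsq' : m' ^ 2 < p' ^ 2 := by gcongr
  have hκκ' : κ < κ' := by by_contra! hn; nlinarith
  have hAp : 0 < A p := mul_pos (by positivity) (by linarith)
  have hApp' : A p < A p' := by unfold A; nlinarith
  have hAmm' : A m < A m' := by rw [hA, hA']; gcongr
  have hmm'sq : m ^ 2 < m' ^ 2 := by
    unfold A at hAmm'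
    by_contra! hn
    nlinarith
  have hmm' : m < m' := lt_of_pow_lt_pow_left₀ 2 hm'.le hmm'sq
  have hlog := log_add_log_of_A_eq hκ hm (by linarith) hp (by linarith) hA
  have hlog' := log_add_log_of_A_eq (hκ.trans hκκ') hm' (by linarith) hp0' (by linarith) hA'
  have hlm : log (1 - m' ^ 2) ≤ log (1 - m ^ 2) := log_le_log (by linarith) (by linarith)
  have hlκ : 10 * X ≤ log κ' - log κ := by
    have h0 : 0 < κ' := hκ.trans hκκ'
    have h1 := one_sub_inv_le_log_of_pos (div_pos h0 hκ)
    rw [inv_div, log_div h0.ne' hκ.ne'] at h1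
    refine le_trans ?_ h1
    rw [one_sub_div h0.ne', le_div_iff₀ h0]
    nlinarith
  have hlp : log (1 - p ^ 2) - log (1 - p' ^ 2) ≤ X := by
    have h1 := log_le_sub_one_of_pos (div_pos (by linarith : 0 < 1 - p ^ 2)
      (by linarith : 0 < 1 - p' ^ 2))
    rw [log_div (by linarith) (by linarith), div_sub_one (by linarith)] at h1
    refine h1.trans ?_
    rw [div_le_iff₀ (by linarith)]
    nlinarith
  set Y := (log m' - log m) - X with hY
  have hYX : 4 * X ≤ Y := by linarith
  have hY0 : 0 < Y := by linarith
  have hexpY : cosh η = exp Y * cosh η' := by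
    rw [hc, hc', hY, hXeq, exp_sub, exp_sub, exp_sub, exp_log hm, exp_log hm', exp_log hp,
      exp_log hp0']
    field_simp
  have hηη' : η' < η := by
    have h1 : cosh η' < cosh η := by
      rw [hexpY]
      exact lt_mul_of_one_lt_left (cosh_pos _) (one_lt_exp_iff.2 hY0)
    rwa [cosh_lt_cosh, abs_of_pos hη, abs_of_pos hη'] at h1
  have hηY : Y ≤ η - η' := by
    have h1 := cosh_le_exp_mul_cosh hηη'.le
    rw [hexpY] at h1
    exact exp_le_exp.1 (le_of_mul_le_mul_right h1 (cosh_pos _))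
  refine ⟨hmm', hηη', ?_⟩
  rw [log_div hm'.ne' hm.ne']
  linarith

theorem integral_inv_sqrt_cosh_lt {m m' p p' η η' : ℝ} (hm : 0 < m) (hmp : m < p)
    (hmp' : m' < p') (hpp' : p < p') (hp' : 32 * p' ^ 2 ≤ 1) (hη' : 0 < η')
    (hc : cosh η = p / m) (hc' : cosh η' = p' / m') (hmm' : m < m') (hηη' : η' < η)
    (h : 4 * log (m' / m) ≤ 5 * (η - η')) :
    ∫ t in 0..η', 1 / √(1 - m' ^ 2 - m' ^ 2 * cosh t ^ 2) <
      ∫ t in 0..η, 1 / √(1 - m ^ 2 - m ^ 2 * cosh t ^ 2) := by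
  have hm' : 0 < m' := hm.trans hmm'
  have hp : 0 < p := hm.trans hmp
  have hp0' : 0 < p' := hp.trans hpp'
  have hppsq : p ^ 2 < p' ^ 2 := by gcongr
  have hmm'sq : m ^ 2 < m' ^ 2 := by gcongr
  have hw : ∀ t ∈ Icc 0 η, 1 / 2 ≤ 1 - m ^ 2 - m ^ 2 * cosh t ^ 2 := fun t ht =>
    one_half_le_of_cosh_le hm hmp (by linarith) hc ht
  have hw' : ∀ t ∈ Icc 0 η', 1 / 2 ≤ 1 - m' ^ 2 - m' ^ 2 * cosh t ^ 2 := fun t ht =>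
    one_half_le_of_cosh_le hm' hmp' (by linarith) hc' ht
  have hi1 := intervalIntegrable_inv_sqrt_cosh hη'.le
    fun t ht => hw t ⟨ht.1, ht.2.trans hηη'.le⟩
  have hi2 := intervalIntegrable_inv_sqrt_cosh hηη'.le
    fun t ht => hw t ⟨hη'.le.trans ht.1, ht.2⟩
  have hi3 := intervalIntegrable_inv_sqrt_cosh hη'.le hw'
  have htail : η - η' ≤ ∫ t in η'..η, 1 / √(1 - m ^ 2 - m ^ 2 * cosh t ^ 2) := by
    have h1 := intervalIntegral.integral_mono_on hηη'.le
      (intervalIntegrable_const (c := (1 : ℝ))) hi2 fun t ht => by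
        have h0 := hw t ⟨hη'.le.trans ht.1, ht.2⟩
        rw [le_div_iff₀ (sqrt_pos.2 (by linarith)), one_mul]
        refine sqrt_le_one.2 ?_
        nlinarith [sq_nonneg (m * cosh t), sq_nonneg m]
    simpa using h1
  have hloss : (∫ t in 0..η', 1 / √(1 - m' ^ 2 - m' ^ 2 * cosh t ^ 2)) -
      (∫ t in 0..η', 1 / √(1 - m ^ 2 - m ^ 2 * cosh t ^ 2)) ≤
      8 * (m' ^ 2 - m ^ 2) * cosh η' * sinh η' := by
    rw [← intervalIntegral.integral_sub hi3 hi1]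
    have h1 : ∫ t in 0..η', 8 * (m' ^ 2 - m ^ 2) * cosh η' * cosh t =
        8 * (m' ^ 2 - m ^ 2) * cosh η' * sinh η' := by
      rw [intervalIntegral.integral_const_mul,
        intervalIntegral.integral_eq_sub_of_hasDerivAt (fun x _ => hasDerivAt_sinh x)
        (continuous_cosh.intervalIntegrable _ _), sinh_zero, sub_zero]
    rw [← h1]
    refine intervalIntegral.integral_mono_on hη'.le (hi3.sub hi1)
      ((continuous_const.mul continuous_cosh).intervalIntegrable _ _) fun t ht => ?_
    have h2 := abs_inv_sqrt_sub_le (s := 2) (by norm_num)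
      (by linarith [hw' t ht] : 1 ≤ 2 * (1 - m' ^ 2 - m' ^ 2 * cosh t ^ 2))
      (by linarith [hw t ⟨ht.1, ht.2.trans hηη'.le⟩] : 1 ≤ 2 * (1 - m ^ 2 - m ^ 2 * cosh t ^ 2))
    refine (le_abs_self _).trans (h2.trans ?_)
    have h3 : (1 - m' ^ 2 - m' ^ 2 * cosh t ^ 2) - (1 - m ^ 2 - m ^ 2 * cosh t ^ 2) =
        -((m' ^ 2 - m ^ 2) * (1 + cosh t ^ 2)) := by ring
    have h4 : 0 ≤ m' ^ 2 - m ^ 2 := by linarith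
    rw [h3, abs_neg, abs_of_nonneg (mul_nonneg h4 (by positivity))]
    have h5 : cosh t ≤ cosh η' := by
      rw [cosh_le_cosh, abs_of_nonneg ht.1, abs_of_pos hη']
      exact ht.2
    have h6 := one_le_cosh t
    have h7 : 1 + cosh t ^ 2 ≤ 2 * (cosh η' * cosh t) := by nlinarith
    have h8 := mul_le_mul_of_nonneg_left h7 h4
    linarith
  have hamp : 8 * (m' ^ 2 - m ^ 2) * cosh η' * sinh η' < η - η' := by
    have h1 := sq_sub_sq_le_log_div hm hmm'.le
    have h3 : cosh η' * sinh η' ≤ (p' / m') ^ 2 := by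
      rw [← hc', pow_two]
      exact mul_le_mul_of_nonneg_left (sinh_lt_cosh _).le (cosh_pos _).le
    have h4 : 0 < log (m' / m) := log_pos ((one_lt_div hm).2 hmm')
    calc 8 * (m' ^ 2 - m ^ 2) * cosh η' * sinh η'
        = 8 * (m' ^ 2 - m ^ 2) * (cosh η' * sinh η') := by ring
      _ ≤ 8 * (m' ^ 2 - m ^ 2) * (p' / m') ^ 2 := by
          refine mul_le_mul_of_nonneg_left h3 (by linarith)
      _ ≤ 8 * (2 * m' ^ 2 * log (m' / m)) * (p' / m') ^ 2 := by gcongr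
      _ = 16 * p' ^ 2 * log (m' / m) := by field_simp; ring
      _ < η - η' := by nlinarith
  have hsplit := intervalIntegral.integral_add_adjacent_intervals hi1 hi2
  linarith

/-- The normalised unknowns attached to the base point `p`: `T` is the common value of both
periods, `(τ, e)` parametrises the outer period, `(m, η)` the inner one, and `α`, `β` are the two
velocities divided by `√(A p)`. -/
structure IsPeriodData (K M p T e τ m η α β : ℝ) : Prop where
  time_pos : 0 < τ
  cosh_time : cosh τ ^ 2 = 1 / p ^ 2 + e
  one_half_le : 1 / 2 ≤ 1 + e * p ^ 2
  eq_weightedTime : T = weightedTime τ e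
  outer_sq : α ^ 2 = (1 + e) * (1 + e * (p ^ 2 / (1 - p ^ 2)))
  min_pos : 0 < m
  min_lt : m < p
  width_pos : 0 < η
  cosh_width : cosh η = p / m
  energy : A m = (1 - β ^ 2) * A p
  eq_integral : T = ∫ t in 0..η, 1 / √(1 - m ^ 2 - m ^ 2 * cosh t ^ 2)
  inner_pos : 0 < β
  inner_lt : β < 1
  linear : 2 * K * α - 2 * M * β = 1

theorem exists_isPeriodData {K M p q r : ℝ} (hp : p ∈ Ioo 0 pstar) (hr : r ∈ Ioo 0 √(A p))
    (hT : Tplus p q = Tminus p r) (h : 2 * K * q - 2 * M * r = √(A p)) :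
    ∃ e τ m η α β, IsPeriodData K M p (Tplus p q) e τ m η α β := by
  obtain ⟨e, τ, hτ, hc, hq, he, hTe⟩ := exists_weightedTime_eq (q := q) hp
  obtain ⟨m, η, hm, hmp, hη, hcη, hA, hTm⟩ := exists_Tminus_eq hp hr
  have hp2 := sq_lt_half_of_mem hp
  have hA0 : 0 < A p := mul_pos (pow_pos hp.1 2) (by linarith)
  have hs := sqrt_pos.2 hA0
  have hsq := sq_sqrt hA0.le
  refine ⟨e, τ, m, η, q / √(A p), r / √(A p), hτ, hc, he, hTe, ?_, hm, hmp, hη, hcη, ?_,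
    hT.trans hTm, div_pos hr.1 hs, (div_lt_one hs).2 hr.2, ?_⟩
  · rw [div_pow, hsq, hq, A]
    have h0 : p ≠ 0 := hp.1.ne'
    have h1 : 1 - p ^ 2 ≠ 0 := by linarith
    field_simp
    ring
  · rw [hA, div_pow, hsq]
    field_simp
  · have hdiv : 2 * K * (q / √(A p)) - 2 * M * (r / √(A p)) = (2 * K * q - 2 * M * r) / √(A p) := by
      ring
    rw [hdiv, h, div_self hs.ne']

theorem one_half_le_of_mul_one_sub_sq_le {D β : ℝ} (hD : 1 ≤ D) (hβ : 0 < β)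
    (h : 10 * D * (1 - β ^ 2) ≤ 1) : 1 / 2 ≤ β := by
  by_contra! hn
  have : β ^ 2 < 1 / 4 := by nlinarith
  nlinarith

theorem le_time_of_exp_mul_sq_le {R p e τ : ℝ} (hp : 0 < p) (he : 0 < 1 + e) (hτ : 0 < τ)
    (hc : cosh τ ^ 2 = 1 / p ^ 2 + e) (hR : (exp (2 * R) + 1) * p ^ 2 ≤ 1) : R ≤ τ := by
  have h1 : exp (2 * R) + 1 ≤ 1 / p ^ 2 := (le_div_iff₀ (by positivity)).2 hR
  have h2 : cosh τ ≤ exp τ := by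
    have := sinh_pos_iff.2 hτ
    rw [← cosh_add_sinh]
    linarith
  have h3 : cosh τ ^ 2 ≤ exp (2 * τ) := by
    have := pow_le_pow_left₀ (cosh_pos τ).le h2 2
    rwa [← exp_nat_mul] at this
  have h4 : exp (2 * R) ≤ exp (2 * τ) := by linarith
  linarith [exp_le_exp.1 h4]

namespace IsPeriodData

variable {K M p T e τ m η α β : ℝ}

theorem parameter_mem (hd : IsPeriodData K M p T e τ m η α β) (hK : 1 ≤ K) (hM : 1 ≤ M)
    (hp : 32 * p ^ 2 ≤ 1) :
    1 ≤ 16 * (K + M) ^ 2 * (1 + e) ∧ 1 + e ≤ 16 * (K + M) ^ 2 := by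
  have hβ := hd.inner_pos
  have hβ1 := hd.inner_lt
  have hlin := hd.linear
  have hα : 1 ≤ 2 * K * α := by nlinarith
  have hα0 : 0 < α := by by_contra! hn; nlinarith
  have hα1 : α ≤ K + M := by nlinarith
  have hα2 : α ^ 2 ≤ (K + M) ^ 2 := pow_le_pow_left₀ hα0.le hα1 2
  have hα3 : 1 ≤ 4 * (K + M) ^ 2 * α ^ 2 := by
    have h1 : 1 ≤ 2 * (K + M) * α := by nlinarith
    nlinarith
  have hsq : α ^ 2 * (1 - p ^ 2) = (1 + e) * (1 + e * p ^ 2 - p ^ 2) := by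
    rw [hd.outer_sq]
    have : 1 - p ^ 2 ≠ 0 := by linarith
    field_simp
    ring
  have hu : 3 / 8 ≤ 1 + e * p ^ 2 - p ^ 2 := by linarith [hd.one_half_le]
  have hN : 1 ≤ (K + M) ^ 2 := by nlinarith
  have hp0 := sq_nonneg p
  have hαp : 0 < α ^ 2 * (1 - p ^ 2) := mul_pos (by positivity) (by linarith)
  have he0 : 0 < 1 + e := by
    by_contra! hn
    nlinarith
  constructor
  · by_contra! hn
    have h1 : 1 + e < 1 := by nlinarith
    have h2 : 1 + e * p ^ 2 - p ^ 2 ≤ 1 := by nlinarith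
    have h3 : α ^ 2 * (1 - p ^ 2) ≤ 1 + e := by nlinarith
    nlinarith
  · nlinarith

theorem time_div_le (hd : IsPeriodData K M p T e τ m η α β) {C : ℝ} (hC : 1 ≤ C)
    (he : 1 ≤ C * (1 + e)) (heC : 1 + e ≤ C) (hτ : 2000 * C ^ 5 ≤ τ) : τ / (2 * C) ≤ T := by
  have hcτ := two_mul_le_cosh_sq hC hτ
  have h := intervalIntegral.integral_mono_on hd.time_pos.le intervalIntegrable_const
    (intervalIntegrable_inv_sqrt_weight hC he heC hcτ le_rfl hd.time_pos.le le_rfl)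
    fun x hx => by
      have := weight_mem hC he heC hcτ hx
      exact (inv_sqrt_mem (by linarith) this.1 this.2).1
  rw [intervalIntegral.integral_const, smul_eq_mul, sub_zero, mul_one_div] at h
  rwa [hd.eq_weightedTime, weightedTime]

theorem le_two_mul_width (hd : IsPeriodData K M p T e τ m η α β) (hp : 32 * p ^ 2 ≤ 1) :
    T ≤ 2 * η := by
  have hw : ∀ t ∈ Icc 0 η, 1 / 2 ≤ 1 - m ^ 2 - m ^ 2 * cosh t ^ 2 := fun t ht =>
    one_half_le_of_cosh_le hd.min_pos hd.min_lt (by linarith) hd.cosh_width ht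
  have h := intervalIntegral.integral_mono_on hd.width_pos.le
    (intervalIntegrable_inv_sqrt_cosh hd.width_pos.le hw)
    (intervalIntegrable_const (c := (2 : ℝ))) fun t ht => by
      refine (inv_sqrt_mem (by norm_num) (by linarith [hw t ht]) ?_).2
      nlinarith [sq_nonneg (m * cosh t), sq_nonneg m]
  rw [intervalIntegral.integral_const, smul_eq_mul, sub_zero, mul_comm] at h
  rwa [hd.eq_integral]

theorem energy_le (hd : IsPeriodData K M p T e τ m η α β) {C R : ℝ} (hC : 1 ≤ C)
    (he : 1 ≤ C * (1 + e)) (heC : 1 + e ≤ C) (hτ : 2000 * C ^ 5 ≤ τ) (hR : 0 ≤ R)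
    (hτR : 32 * C ^ 2 * R ≤ τ) (hp0 : 0 < p) (hp : 32 * p ^ 2 ≤ 1) : R * (1 - β ^ 2) ≤ 1 := by
  have hC5 : 1 ≤ C ^ 5 := one_le_pow₀ hC
  have h1 := hd.time_div_le hC he heC hτ
  have h2 := hd.le_two_mul_width hp
  have hη : τ ≤ 4 * C * η := by
    rw [div_le_iff₀ (by linarith)] at h1
    nlinarith
  have hcη : η ≤ p / m := hd.cosh_width ▸ le_cosh_of_nonneg hd.width_pos.le
  have hm := hd.min_pos
  rw [le_div_iff₀ hm] at hcη
  have hA := hd.energy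
  unfold A at hA
  have hβ : 0 < 1 - β ^ 2 := by nlinarith [hd.inner_pos, hd.inner_lt]
  have hmp : m ^ 2 * (1 - m ^ 2) ≤ m ^ 2 := by nlinarith [sq_nonneg (m ^ 2)]
  have hm2 : (1 - β ^ 2) * p ^ 2 ≤ 2 * m ^ 2 := by
    have := mul_pos hβ (pow_pos hp0 2)
    nlinarith
  have hRη : 2 * R ≤ η ^ 2 := by
    have h3 : τ ^ 2 ≤ (4 * C * η) ^ 2 := pow_le_pow_left₀ hd.time_pos.le hη 2
    have h4 : τ ≤ τ ^ 2 := by nlinarith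
    have h5 : 16 * C ^ 2 * (2 * R) ≤ 16 * C ^ 2 * η ^ 2 := by linarith
    exact le_of_mul_le_mul_left h5 (by positivity)
  have hηm : (η * m) ^ 2 ≤ p ^ 2 := pow_le_pow_left₀ (mul_pos hd.width_pos hm).le hcη 2
  have h6 : R * (1 - β ^ 2) * p ^ 2 ≤ 1 * p ^ 2 := by
    calc R * (1 - β ^ 2) * p ^ 2 = R * ((1 - β ^ 2) * p ^ 2) := by ring
      _ ≤ R * (2 * m ^ 2) := by gcongr
      _ = 2 * R * m ^ 2 := by ring
      _ ≤ η ^ 2 * m ^ 2 := by gcongr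
      _ ≤ 1 * p ^ 2 := by linarith
  exact le_of_mul_le_mul_right h6 (pow_pos hp0 2)

theorem period_lt {p' T' e' τ' m' η' α' β' C D : ℝ} (hd : IsPeriodData K M p T e τ m η α β)
    (hd' : IsPeriodData K M p' T' e' τ' m' η' α' β') (hK : 1 ≤ K) (hM : 1 ≤ M)
    (hC : C = 16 * (K + M) ^ 2) (hD : D = 2 * (K + M) ^ 2 * (1024 * C ^ 3))
    (hp : 0 < p) (hpp' : p < p') (hp' : 8192 * C ^ 5 * p' ^ 2 ≤ 1)
    (hτ : 2000 * C ^ 5 + 32 * C ^ 2 * (10 * D) ≤ τ)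
    (hτ' : 2000 * C ^ 5 + 32 * C ^ 2 * (10 * D) ≤ τ') : T' < T := by
  by_contra! hT
  have hN : 1 ≤ (K + M) ^ 2 := one_le_pow₀ (by linarith)
  have hC1 : 1 ≤ C := by linarith
  have hC3 : 1 ≤ C ^ 3 := one_le_pow₀ hC1
  have hC5 : 1 ≤ C ^ 5 := one_le_pow₀ hC1
  have hD1 : 1 ≤ D := by
    rw [hD]
    exact one_le_mul_of_one_le_of_one_le (by linarith) (by linarith)
  have hCD : 0 ≤ 32 * C ^ 2 * (10 * D) := by positivity
  have hp32' : 32 * p' ^ 2 ≤ 1 :=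
    (mul_le_mul_of_nonneg_right (by linarith) (sq_nonneg p')).trans hp'
  have hpp'sq : p ^ 2 < p' ^ 2 := by gcongr
  have hp32 : 32 * p ^ 2 ≤ 1 := by linarith
  obtain ⟨he, heC⟩ := hd.parameter_mem hK hM hp32
  obtain ⟨he', heC'⟩ := hd'.parameter_mem hK hM hp32'
  rw [← hC] at he heC he' heC'
  have hτC : 2000 * C ^ 5 ≤ τ := by linarith
  have hτC' : 2000 * C ^ 5 ≤ τ' := by linarith
  have hX := log_div_le_parameter_sub hC1 he heC he' heC' hp hpp' hτC hτC' hd.cosh_time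
    hd'.cosh_time (by rwa [← hd.eq_weightedTime, ← hd'.eq_weightedTime])
  have hX' := log_div_le_amplitude_sub hC1 he he' heC' hp hpp' hp' hX
  rw [← hd.outer_sq, ← hd'.outer_sq] at hX'
  have hκ := hd.energy_le (R := 10 * D) hC1 he heC hτC (by linarith) (by linarith) hp hp32
  have hκ' := hd'.energy_le (R := 10 * D) hC1 he' heC' hτC' (by linarith) (by linarith)
    (hp.trans hpp') hp32'
  have hβ0 := hd.inner_pos
  have hβ0' := hd'.inner_pos
  have hκ0 : 0 < 1 - β ^ 2 := sub_pos.2 (pow_lt_one₀ hβ0.le hd.inner_lt two_ne_zero)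
  have hβ := one_half_le_of_mul_one_sub_sq_le hD1 hβ0 hκ
  have hβ' := one_half_le_of_mul_one_sub_sq_le hD1 hβ0' hκ'
  have hX'' := le_sq_sub_sq_of_linear_relation (by positivity)
    (log_pos ((one_lt_div hp).2 hpp')) hK hM hβ hβ' hd.inner_lt.le hd'.inner_lt.le hd.linear
    hd'.linear hX'
  rw [← hD] at hX''
  obtain ⟨hmm', hηη', hlog⟩ := log_div_le_half_width_sub hD1 hκ0 hκ' hd.min_pos hd.min_lt
    hd'.min_pos hd'.min_lt hpp' hp32' hd.width_pos hd'.width_pos hd.cosh_width hd'.cosh_width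
    hd.energy hd'.energy (by linarith)
  have hlt := integral_inv_sqrt_cosh_lt hd.min_pos hd.min_lt hd'.min_lt hpp' hp32' hd'.width_pos
    hd.cosh_width hd'.cosh_width hmm' hηη' hlog
  rw [← hd.eq_integral, ← hd'.eq_integral] at hlt
  linarith

end IsPeriodData

theorem exists_forall_isPeriodData_le {K M C : ℝ} (hK : 1 ≤ K) (hM : 1 ≤ M)
    (hC : C = 16 * (K + M) ^ 2) (R : ℝ) :
    ∃ δ ∈ Ioo 0 pstar, ∀ p ∈ Ioo 0 δ, 8192 * C ^ 5 * p ^ 2 ≤ 1 ∧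
      ∀ T e τ m η α β, IsPeriodData K M p T e τ m η α β →
        1 ≤ C * (1 + e) ∧ 1 + e ≤ C ∧ R ≤ τ := by
  have hN : 1 ≤ (K + M) ^ 2 := by nlinarith
  have hC5 : 1 ≤ C ^ 5 := one_le_pow₀ (by linarith)
  have hexp := exp_pos (2 * R)
  have hQ : 0 < 8192 * C ^ 5 + (exp (2 * R) + 1) := by linarith
  refine ⟨1 / (8192 * C ^ 5 + (exp (2 * R) + 1)), ⟨by positivity, ?_⟩, fun p hp => ?_⟩
  · unfold pstar
    refine one_div_lt_one_div_of_lt (by positivity) ?_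
    have := sqrt_two_lt_three_halves
    linarith
  · have h1 : p * (8192 * C ^ 5 + (exp (2 * R) + 1)) < 1 := (lt_div_iff₀ hQ).1 hp.2
    have hp1 : p < 1 := by nlinarith [hp.1]
    have h2 : (8192 * C ^ 5 + (exp (2 * R) + 1)) * p ^ 2 ≤ 1 := by nlinarith [hp.1]
    have hp2 : 0 < p ^ 2 := pow_pos hp.1 2
    have h3 : 8192 * C ^ 5 * p ^ 2 ≤ 1 := by nlinarith
    refine ⟨h3, fun T e τ m η α β hd => ?_⟩
    obtain ⟨he, heC⟩ := hd.parameter_mem hK hM (by nlinarith)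
    rw [← hC] at he heC
    refine ⟨he, heC, le_time_of_exp_mul_sq_le hp.1 ?_ hd.time_pos hd.cosh_time (by nlinarith)⟩
    by_contra! hn
    nlinarith

/-- fix `N ≥ 2`, `1 ≤ K ≤ N−1`, and let `q₁, q_N` select, for each
`p₀ ∈ (0, p⋆)`, the unique pair with `q₁(p₀) > 0`, `q_N(p₀) ∈ (0, √A(p₀))` solving
`T₊(p₀, q₁(p₀)) = T₋(p₀, q_N(p₀))` and `2Kq₁(p₀) − 2(N−K)q_N(p₀) = √A(p₀)`. Then
`T₊(p₀, q₁(p₀)) → ∞` as `p₀ → 0⁺` and there is `p_∞ ∈ (0, p⋆)` such that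
`p₀ ↦ T₊(p₀, q₁(p₀))` is strictly decreasing on `(0, p_∞)`. -/
theorem Ksplit_period_diverges (N K : ℕ) (hN : 2 ≤ N) (hK1 : 1 ≤ K) (hKN : K ≤ N - 1)
    (q₁ qN : ℝ → ℝ)
    (hsol : ∀ p₀ ∈ Set.Ioo 0 pstar,
      0 < q₁ p₀ ∧ qN p₀ ∈ Set.Ioo 0 (Real.sqrt (A p₀)) ∧
      Tplus p₀ (q₁ p₀) = Tminus p₀ (qN p₀) ∧
      2 * (K : ℝ) * q₁ p₀ - 2 * ((N : ℝ) - (K : ℝ)) * qN p₀ = Real.sqrt (A p₀))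
    (huniq : ∀ p₀ ∈ Set.Ioo 0 pstar, ∀ a b : ℝ,
      0 < a → b ∈ Set.Ioo 0 (Real.sqrt (A p₀)) →
      Tplus p₀ a = Tminus p₀ b →
      2 * (K : ℝ) * a - 2 * ((N : ℝ) - (K : ℝ)) * b = Real.sqrt (A p₀) →
      a = q₁ p₀ ∧ b = qN p₀) :
    Tendsto (fun p₀ => Tplus p₀ (q₁ p₀)) (nhdsWithin 0 (Set.Ioi 0)) atTop ∧
    ∃ pinf ∈ Set.Ioo 0 pstar,
      StrictAntiOn (fun p₀ => Tplus p₀ (q₁ p₀)) (Set.Ioo 0 pinf) := by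
  have hK : (1 : ℝ) ≤ K := by exact_mod_cast hK1
  have hM : (1 : ℝ) ≤ (N : ℝ) - K := by
    have : K + 1 ≤ N := by omega
    have : (K : ℝ) + 1 ≤ N := by exact_mod_cast this
    linarith
  obtain ⟨C, hC⟩ : ∃ C : ℝ, C = 16 * ((K : ℝ) + (N - K)) ^ 2 := ⟨_, rfl⟩
  have hC1 : 1 ≤ C := by nlinarith
  have hdata : ∀ p ∈ Ioo 0 pstar, ∃ e τ m η α β,
      IsPeriodData K (N - K) p (Tplus p (q₁ p)) e τ m η α β := fun p hp => by
    obtain ⟨-, hr, hT, hlin⟩ := hsol p hp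
    exact exists_isPeriodData hp hr hT hlin
  constructor
  · refine tendsto_atTop.2 fun B => ?_
    obtain ⟨δ, hδ, h⟩ := exists_forall_isPeriodData_le hK hM hC (max (2000 * C ^ 5) (2 * C * B))
    filter_upwards [Ioo_mem_nhdsGT hδ.1] with p hp
    obtain ⟨e, τ, m, η, α, β, hd⟩ := hdata p ⟨hp.1, hp.2.trans hδ.2⟩
    obtain ⟨he, heC, hτ⟩ := (h p hp).2 _ _ _ _ _ _ _ hd
    refine le_trans ?_ (hd.time_div_le hC1 he heC ((le_max_left _ _).trans hτ))
    rw [le_div_iff₀ (by linarith), mul_comm]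
    exact (le_max_right _ _).trans hτ
  · obtain ⟨D, hD⟩ : ∃ D : ℝ, D = 2 * ((K : ℝ) + (N - K)) ^ 2 * (1024 * C ^ 3) := ⟨_, rfl⟩
    obtain ⟨δ, hδ, h⟩ := exists_forall_isPeriodData_le hK hM hC
      (2000 * C ^ 5 + 32 * C ^ 2 * (10 * D))
    refine ⟨δ, hδ, fun p hp p' hp' hpp' => ?_⟩
    obtain ⟨e, τ, m, η, α, β, hd⟩ := hdata p ⟨hp.1, hp.2.trans hδ.2⟩
    obtain ⟨e', τ', m', η', α', β', hd'⟩ := hdata p' ⟨hp'.1, hp'.2.trans hδ.2⟩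
    exact hd.period_lt hd' hK hM hC hD hp.1 hpp' (h p' hp').1
      ((h p hp).2 _ _ _ _ _ _ _ hd).2.2 ((h p' hp').2 _ _ _ _ _ _ _ hd').2.2
end

section
/- Fix an integer N ≥ 1. For every ε > 0 there exists exactly one p₀ ∈ (0,1) with 𝒯(p₀) = πε, and for this p₀ there exists an even function u ∈ C²([−πε, πε]) solving −u''(z) + u(z) − 2u(z)³ = 0 on (−πε, πε) with boundary values u(−πε) = u(πε) = p₀ and derivatives u'(−πε) = −u'(πε) = (1/(2N))√A(p₀), such that u(z) > 0 on [−πε, πε] and u'(z) < 0 for every z ∈ (0, πε] (so u is a positive single-lobe profile with its unique maximum at z = 0). -/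
open Real MeasureTheory Set Filter Topology

/-- `𝒯(p₀) = T₊(p₀, (1/(2N))√A(p₀))`. -/
noncomputable def calT (N : ℕ) (p₀ : ℝ) : ℝ :=
  Tplus p₀ (1 / (2 * (N : ℝ)) * Real.sqrt (A p₀))

/-- The density `dz/dθ` of the travel time in the phase `θ` defined by `2u² = 1 + s cos θ`. -/
noncomputable def phaseDensity (s θ : ℝ) : ℝ := 1 / √(2 * (1 + s * cos θ))

/-- The travel time from the maximum of the profile (phase `0`) to phase `θ`. -/
noncomputable def phaseTime (s θ : ℝ) : ℝ := ∫ φ in (0 : ℝ)..θ, phaseDensity s φ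

lemma one_add_mul_cos_pos {s : ℝ} (h0 : 0 ≤ s) (h1 : s < 1) (θ : ℝ) : 0 < 1 + s * cos θ := by
  nlinarith [neg_one_le_cos θ]

lemma phaseDensity_pos {s : ℝ} (h0 : 0 ≤ s) (h1 : s < 1) (θ : ℝ) : 0 < phaseDensity s θ := by
  have := one_add_mul_cos_pos h0 h1 θ
  unfold phaseDensity
  positivity

lemma continuous_phaseDensity {s : ℝ} (h0 : 0 ≤ s) (h1 : s < 1) :
    Continuous (phaseDensity s) := by
  unfold phaseDensity
  refine continuous_const.div (by fun_prop) fun θ => ?_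
  have := one_add_mul_cos_pos h0 h1 θ
  positivity

lemma hasDerivAt_phaseTime {s : ℝ} (h0 : 0 ≤ s) (h1 : s < 1) (θ : ℝ) :
    HasDerivAt (phaseTime s) (phaseDensity s θ) θ :=
  ((continuous_phaseDensity h0 h1).integral_hasStrictDerivAt 0 θ).hasDerivAt

lemma strictMono_phaseTime {s : ℝ} (h0 : 0 ≤ s) (h1 : s < 1) : StrictMono (phaseTime s) :=
  strictMono_of_deriv_pos fun θ => by
    rw [(hasDerivAt_phaseTime h0 h1 θ).deriv]; exact phaseDensity_pos h0 h1 θ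

lemma phaseTime_neg (s θ : ℝ) : phaseTime s (-θ) = -phaseTime s θ := by
  have h := intervalIntegral.integral_comp_neg (a := 0) (b := θ) (phaseDensity s)
  have he : ∀ x, phaseDensity s (-x) = phaseDensity s x := fun x => by
    simp [phaseDensity]
  simp only [he, neg_zero] at h
  rw [phaseTime, phaseTime, intervalIntegral.integral_symm, h]

lemma half_le_phaseDensity {s : ℝ} (h0 : 0 ≤ s) (h1 : s < 1) (θ : ℝ) :
    1 / 2 ≤ phaseDensity s θ := by
  have h := one_add_mul_cos_pos h0 h1 θ
  unfold phaseDensity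
  refine one_div_le_one_div_of_le (by positivity) ?_
  rw [sqrt_le_left (by norm_num)]
  nlinarith [cos_le_one θ]

lemma half_mul_le_phaseTime {s : ℝ} (h0 : 0 ≤ s) (h1 : s < 1) {θ : ℝ} (hθ : 0 ≤ θ) :
    θ / 2 ≤ phaseTime s θ := by
  have h := intervalIntegral.integral_mono_on (μ := volume) hθ (f := fun _ => (1 / 2 : ℝ))
    (by simp) ((continuous_phaseDensity h0 h1).intervalIntegrable 0 θ)
    (fun x _ => half_le_phaseDensity h0 h1 x)
  simp only [intervalIntegral.integral_const, smul_eq_mul] at h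
  unfold phaseTime
  linarith

lemma surjective_phaseTime {s : ℝ} (h0 : 0 ≤ s) (h1 : s < 1) :
    Function.Surjective (phaseTime s) := by
  have hcont : Continuous (phaseTime s) :=
    continuous_iff_continuousAt.2 fun θ => (hasDerivAt_phaseTime h0 h1 θ).continuousAt
  refine hcont.surjective ?_ ?_
  · refine tendsto_atTop_mono' atTop ?_ (tendsto_id.atTop_div_const (by norm_num : (0 : ℝ) < 2))
    filter_upwards [eventually_ge_atTop 0] with θ hθ using half_mul_le_phaseTime h0 h1 hθ
  · refine tendsto_atBot_mono' atBot ?_ (tendsto_id.atBot_div_const (by norm_num : (0 : ℝ) < 2))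
    filter_upwards [eventually_le_atBot 0] with θ hθ
    have := half_mul_le_phaseTime h0 h1 (neg_nonneg.2 hθ)
    rw [phaseTime_neg] at this
    simp only [id]
    linarith

/-- The phase as a function of the position along the profile. -/
lemma exists_phase {s : ℝ} (h0 : 0 ≤ s) (h1 : s < 1) :
    ∃ Θ : ℝ → ℝ, StrictMono Θ ∧ (∀ θ, Θ (phaseTime s θ) = θ) ∧ (∀ z, Θ (-z) = -Θ z) ∧
      ∀ z, HasDerivAt Θ (√(2 * (1 + s * cos (Θ z)))) z := by
  let e := (strictMono_phaseTime h0 h1).orderIsoOfSurjective _ (surjective_phaseTime h0 h1)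
  have hl : ∀ θ, e.symm (phaseTime s θ) = θ := fun θ => e.symm_apply_apply θ
  have hr : ∀ z, phaseTime s (e.symm z) = z := fun z => e.apply_symm_apply z
  refine ⟨e.symm, e.symm.strictMono, hl, fun z => ?_, fun z => ?_⟩
  · conv_lhs => rw [← hr z, ← phaseTime_neg, hl]
  · have := HasDerivAt.of_local_left_inverse e.symm.continuous.continuousAt
      (hasDerivAt_phaseTime h0 h1 (e.symm z)) (phaseDensity_pos h0 h1 _).ne'
      (Eventually.of_forall hr)
    simpa [phaseDensity] using this

lemma exists_lobe {s θ₀ : ℝ} (h0 : 0 < s) (h1 : s < 1) (hθ₀ : θ₀ ∈ Ioo 0 π) :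
    ∃ u : ℝ → ℝ, ContDiff ℝ 2 u ∧ (∀ z, u (-z) = u z) ∧
      (∀ z, -deriv (deriv u) z + u z - 2 * u z ^ 3 = 0) ∧
      u (phaseTime s θ₀) = √((1 + s * cos θ₀) / 2) ∧
      deriv u (-phaseTime s θ₀) = s * sin θ₀ / 2 ∧
      deriv u (phaseTime s θ₀) = -(s * sin θ₀ / 2) ∧
      (∀ z, 0 < u z) ∧ ∀ z ∈ Ioc 0 (phaseTime s θ₀), deriv u z < 0 := by
  obtain ⟨Θ, hmono, hinv, hodd, hΘ⟩ := exists_phase h0.le h1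
  set u : ℝ → ℝ := fun z => √((1 + s * cos (Θ z)) / 2) with hu
  have hpos : ∀ z, 0 < (1 + s * cos (Θ z)) / 2 := fun z =>
    half_pos (one_add_mul_cos_pos h0.le h1 _)
  have hupos : ∀ z, 0 < u z := fun z => sqrt_pos.2 (hpos z)
  have husq : ∀ z, u z ^ 2 = (1 + s * cos (Θ z)) / 2 := fun z => sq_sqrt (hpos z).le
  have hΘ' : ∀ z, HasDerivAt Θ (2 * u z) z := fun z => by
    convert hΘ z using 1
    rw [show 2 * (1 + s * cos (Θ z)) = (2 * u z) ^ 2 by rw [mul_pow, husq]; ring,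
      sqrt_sq (by linarith [hupos z])]
  have hu' : ∀ z, HasDerivAt u (-(s * sin (Θ z) / 2)) z := fun z => by
    have h := (((((hΘ' z).cos).const_mul s).const_add 1).div_const 2).sqrt (hpos z).ne'
    convert h using 1
    have := (hupos z).ne'
    change _ = _ / (2 * u z)
    field_simp
  have hd : deriv u = fun z => -(s * sin (Θ z) / 2) := funext fun z => (hu' z).deriv
  have hu'' : ∀ z, HasDerivAt (deriv u) (u z - 2 * u z ^ 3) z := fun z => by
    rw [hd]
    refine ((((hΘ' z).sin).const_mul s).div_const 2).neg.congr_deriv ?_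
    linear_combination (2 * u z) * husq z
  have hdd : deriv (deriv u) = fun z => u z - 2 * u z ^ 3 := funext fun z => (hu'' z).deriv
  have hdiff : Differentiable ℝ u := fun z => (hu' z).differentiableAt
  have hΘ0 : Θ 0 = 0 := by have := hodd 0; rw [neg_zero] at this; linarith
  refine ⟨u, ?_, fun z => ?_, fun z => ?_, ?_, ?_, ?_, hupos, fun z hz => ?_⟩
  · rw [show (2 : WithTop ℕ∞) = 1 + 1 by norm_num, contDiff_succ_iff_deriv]
    refine ⟨hdiff, by simp, contDiff_one_iff_deriv.2
      ⟨fun z => (hu'' z).differentiableAt, ?_⟩⟩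
    rw [hdd]
    have := hdiff.continuous
    fun_prop
  · simp only [hu, hodd, cos_neg]
  · rw [hdd]; ring
  · simp only [hu, hinv]
  · rw [hd, ← phaseTime_neg]
    simp [hinv, neg_div]
  · rw [hd]
    simp [hinv]
  · rw [hd]
    have h1 : 0 < Θ z := hΘ0 ▸ hmono hz.1
    have h2 : Θ z ≤ θ₀ := hinv θ₀ ▸ hmono.monotone hz.2
    have := sin_pos_of_pos_of_lt_pi h1 (h2.trans_lt hθ₀.2)
    simp only
    have := mul_pos h0 this
    linarith

/-- The substitution `2u² = 1 + s cos θ` in the period integral. -/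
lemma integral_eq_phaseTime {s θ₀ : ℝ} (h0 : 0 < s) (h1 : s < 1) (hθ₀ : θ₀ ∈ Ioo 0 π) :
    ∫ u in √((1 + s * cos θ₀) / 2)..√((1 + s) / 2), 1 / √((s ^ 2 - 1) / 4 + A u) =
      phaseTime s θ₀ := by
  set U : ℝ → ℝ := fun θ => √((1 + s * cos θ) / 2) with hU
  have hpos : ∀ θ, 0 < (1 + s * cos θ) / 2 := fun θ => half_pos (one_add_mul_cos_pos h0.le h1 _)
  have hUpos : ∀ θ, 0 < U θ := fun θ => sqrt_pos.2 (hpos θ)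
  have hUsq : ∀ θ, U θ ^ 2 = (1 + s * cos θ) / 2 := fun θ => sq_sqrt (hpos θ).le
  have hU' : ∀ θ, HasDerivAt U (-(s * sin θ) / (4 * U θ)) θ := fun θ => by
    have h := (((((hasDerivAt_id θ).cos).const_mul s).const_add 1).div_const 2).sqrt (hpos θ).ne'
    refine h.congr_deriv ?_
    have := (hUpos θ).ne'
    change _ / (2 * U θ) = _
    simp only [id]
    field_simp
    ring
  have hanti : StrictAntiOn U (Icc 0 θ₀) := fun x hx y hy hxy => by
    have := strictAntiOn_cos ⟨hx.1, hx.2.trans hθ₀.2.le⟩ ⟨hy.1, hy.2.trans hθ₀.2.le⟩ hxy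
    refine sqrt_lt_sqrt (hpos y).le ?_
    have := mul_lt_mul_of_pos_left this h0
    linarith
  have himage : U '' Ioo 0 θ₀ = Ioo (U θ₀) (U 0) := by
    refine Subset.antisymm ?_ ?_
    · rintro _ ⟨x, hx, rfl⟩
      exact ⟨hanti ⟨hx.1.le, hx.2.le⟩ ⟨hθ₀.1.le, le_rfl⟩ hx.2,
        hanti ⟨le_rfl, hθ₀.1.le⟩ ⟨hx.1.le, hx.2.le⟩ hx.1⟩
    · exact intermediate_value_Ioo' hθ₀.1.le
        fun x _ => (hU' x).continuousAt.continuousWithinAt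
  have hU0 : √((1 + s) / 2) = U 0 := by simp [hU]
  have hle : U θ₀ ≤ U 0 := (hanti ⟨le_rfl, hθ₀.1.le⟩ ⟨hθ₀.1.le, le_rfl⟩ hθ₀.1).le
  change ∫ u in U θ₀.._, _ = _
  rw [hU0, intervalIntegral.integral_of_le hle, integral_Ioc_eq_integral_Ioo, ← himage,
    integral_image_eq_integral_abs_deriv_smul measurableSet_Ioo
      (fun x _ => (hU' x).hasDerivWithinAt) (hanti.injOn.mono Ioo_subset_Icc_self),
    phaseTime, intervalIntegral.integral_of_le hθ₀.1.le, integral_Ioc_eq_integral_Ioo]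
  refine setIntegral_congr_fun measurableSet_Ioo fun θ hθ => ?_
  have hsin : 0 < s * sin θ := mul_pos h0 (sin_pos_of_pos_of_lt_pi hθ.1 (hθ.2.trans hθ₀.2))
  have hA : √((s ^ 2 - 1) / 4 + A (U θ)) = s * sin θ / 2 := by
    rw [show (s ^ 2 - 1) / 4 + A (U θ) = (s * sin θ / 2) ^ 2 by
      rw [A, hUsq]
      linear_combination (-s ^ 2 / 4) * sin_sq_add_cos_sq θ, sqrt_sq (by linarith)]
  have hD : √(2 * (1 + s * cos θ)) = 2 * U θ := by
    rw [show 2 * (1 + s * cos θ) = (2 * U θ) ^ 2 by rw [mul_pow, hUsq]; ring,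
      sqrt_sq (by linarith [hUpos θ])]
  have := hUpos θ
  simp only [smul_eq_mul, phaseDensity, hA, hD]
  rw [abs_div, abs_neg, abs_of_pos hsin, abs_of_pos (by linarith)]
  generalize s * sin θ = y at hsin
  field_simp
  norm_num

/-- `s = √(1 + 4E)` as a function of `w = 2p₀² − 1`, where `q₀² = c A(p₀)`. -/
noncomputable def modulus (c w : ℝ) : ℝ := √(c + (1 - c) * w ^ 2)

/-- The phase of the boundary point `p₀`, as a function of `w = 2p₀² − 1`. -/
noncomputable def endPhase (c w : ℝ) : ℝ := arccos (w / modulus c w)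

/-- The period function in terms of `w = 2p₀² − 1`. -/
noncomputable def lobeTime (c w : ℝ) : ℝ := phaseTime (modulus c w) (endPhase c w)

lemma modulus_sq {c : ℝ} (hc : c ∈ Ioo (0 : ℝ) 1) (w : ℝ) : modulus c w ^ 2 = c + (1 - c) * w ^ 2 :=
  sq_sqrt (by nlinarith [hc.1, hc.2, sq_nonneg w])

lemma modulus_pos {c : ℝ} (hc : c ∈ Ioo (0 : ℝ) 1) (w : ℝ) : 0 < modulus c w :=
  sqrt_pos.2 (by nlinarith [hc.1, hc.2, sq_nonneg w])

lemma modulus_lt_one {c : ℝ} (hc : c ∈ Ioo (0 : ℝ) 1) {w : ℝ} (hw : w ∈ Ioo (-1 : ℝ) 1) :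
    modulus c w < 1 := by
  rw [modulus, sqrt_lt' one_pos]
  nlinarith [hc.2, mul_pos (sub_pos.2 hw.1) (sub_pos.2 hw.2)]

lemma abs_lt_modulus {c : ℝ} (hc : c ∈ Ioo (0 : ℝ) 1) {w : ℝ} (hw : w ∈ Ioo (-1 : ℝ) 1) :
    |w| < modulus c w := by
  refine abs_lt_of_sq_lt_sq ?_ (modulus_pos hc w).le
  rw [modulus_sq hc]
  nlinarith [hc.1, mul_pos (sub_pos.2 hw.1) (sub_pos.2 hw.2)]

lemma div_modulus_mem {c : ℝ} (hc : c ∈ Ioo (0 : ℝ) 1) {w : ℝ} (hw : w ∈ Ioo (-1 : ℝ) 1) :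
    w / modulus c w ∈ Ioo (-1 : ℝ) 1 := by
  rw [mem_Ioo, ← abs_lt, abs_div, abs_of_pos (modulus_pos hc w), div_lt_one (modulus_pos hc w)]
  exact abs_lt_modulus hc hw

lemma endPhase_mem {c : ℝ} (hc : c ∈ Ioo (0 : ℝ) 1) {w : ℝ} (hw : w ∈ Ioo (-1 : ℝ) 1) :
    endPhase c w ∈ Ioo 0 π := by
  have h := div_modulus_mem hc hw
  refine ⟨arccos_pos.2 h.2, (arccos_le_pi _).lt_of_ne fun he => ?_⟩
  rw [arccos_eq_pi] at he
  exact absurd h.1 he.not_gt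

lemma modulus_mul_cos_endPhase {c : ℝ} (hc : c ∈ Ioo (0 : ℝ) 1) {w : ℝ} (hw : w ∈ Ioo (-1 : ℝ) 1) :
    modulus c w * cos (endPhase c w) = w := by
  have h := div_modulus_mem hc hw
  rw [endPhase, cos_arccos h.1.le h.2.le, mul_div_cancel₀ _ (modulus_pos hc w).ne']

lemma modulus_mul_sin_endPhase {c : ℝ} (hc : c ∈ Ioo (0 : ℝ) 1) {w : ℝ} (hw : w ∈ Ioo (-1 : ℝ) 1) :
    modulus c w * sin (endPhase c w) = √(c * (1 - w ^ 2)) := by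
  have hs := sin_pos_of_mem_Ioo (endPhase_mem hc hw)
  rw [eq_comm, ← sqrt_sq (mul_pos (modulus_pos hc w) hs).le]
  congr 1
  have h := modulus_mul_cos_endPhase hc hw
  linear_combination (-(modulus c w) ^ 2) * sin_sq_add_cos_sq (endPhase c w) - modulus_sq hc w +
    (modulus c w * cos (endPhase c w) + w) * h

lemma modulus_le_modulus {c : ℝ} (hc : c ∈ Ioo (0 : ℝ) 1) {v w : ℝ} (h : v ^ 2 ≤ w ^ 2) :
    modulus c v ≤ modulus c w :=
  sqrt_le_sqrt (by nlinarith [hc.2])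

lemma endPhase_strictAntiOn {c : ℝ} (hc : c ∈ Ioo (0 : ℝ) 1) :
    StrictAntiOn (endPhase c) (Ioo (-1) 1) := by
  have key : ∀ {w}, w ∈ Ioo (-1 : ℝ) 1 → cos (endPhase c w) = w / modulus c w := fun {w} hw => by
    have h := div_modulus_mem hc hw
    exact cos_arccos h.1.le h.2.le
  have hsq : ∀ w, modulus c w ^ 2 = c + (1 - c) * w ^ 2 := modulus_sq hc
  intro v hv w hw hvw
  refine strictAntiOn_arccos (Ioo_subset_Icc_self (div_modulus_mem hc hv))
    (Ioo_subset_Icc_self (div_modulus_mem hc hw)) ?_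
  have hv0 := modulus_pos hc v
  have hw0 := modulus_pos hc w
  rw [div_lt_div_iff₀ hv0 hw0]
  rcases le_or_gt 0 v with h | h
  · refine lt_of_pow_lt_pow_left₀ 2 (mul_nonneg (h.trans hvw.le) hv0.le) ?_
    rw [mul_pow, mul_pow, hsq, hsq]
    nlinarith [mul_pos hc.1 (mul_pos (sub_pos.2 hvw) (by linarith : 0 < v + w))]
  · rcases le_or_gt 0 w with h' | h'
    · nlinarith [mul_neg_of_neg_of_pos h hw0, mul_nonneg h' hv0.le]
    · rw [← neg_lt_neg_iff, ← neg_mul, ← neg_mul]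
      refine lt_of_pow_lt_pow_left₀ 2 (mul_nonneg (by linarith) hw0.le) ?_
      rw [mul_pow, mul_pow, hsq, hsq]
      nlinarith [mul_pos hc.1 (mul_pos (sub_pos.2 hvw) (by linarith : 0 < -v + -w))]

lemma lobeTime_strictAntiOn_nonneg {c : ℝ} (hc : c ∈ Ioo (0 : ℝ) 1) :
    StrictAntiOn (lobeTime c) (Ico 0 1) := by
  intro v hv w hw hvw
  have hv' : v ∈ Ioo (-1 : ℝ) 1 := ⟨by linarith [hv.1], hv.2⟩
  have hw' : w ∈ Ioo (-1 : ℝ) 1 := ⟨by linarith [hw.1], hw.2⟩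
  have hsv := modulus_pos hc v
  have hsw := modulus_pos hc w
  have hsv1 := modulus_lt_one hc hv'
  have hsw1 := modulus_lt_one hc hw'
  have hle : modulus c v ≤ modulus c w := modulus_le_modulus hc (by nlinarith [hv.1])
  have hθw := endPhase_mem hc hw'
  calc lobeTime c w ≤ phaseTime (modulus c v) (endPhase c w) := by
        refine intervalIntegral.integral_mono_on hθw.1.le
          ((continuous_phaseDensity hsw.le hsw1).intervalIntegrable _ _)
          ((continuous_phaseDensity hsv.le hsv1).intervalIntegrable _ _) fun θ hθ => ?_
        have h2 : θ ≤ π / 2 :=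
          hθ.2.trans (arccos_le_pi_div_two.2 (div_nonneg hw.1 hsw.le))
        have hcos : 0 ≤ cos θ := cos_nonneg_of_mem_Icc ⟨by linarith [hθ.1, pi_pos], h2⟩
        have := one_add_mul_cos_pos hsv.le hsv1 θ
        refine one_div_le_one_div_of_le (by positivity) (sqrt_le_sqrt ?_)
        nlinarith [mul_le_mul_of_nonneg_right hle hcos]
    _ < lobeTime c v := by
      have hphase := endPhase_strictAntiOn hc hv' hw' hvw
      exact strictMono_phaseTime hsv.le hsv1 hphase

/-- Subtracting the linear part of `(1 + y)^(-1/2)` at `0` leaves a function which is antitone on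
the left and monotone on the right of `0`. -/
lemma invSqrt_add_half_le {x y : ℝ} (hx : -1 < x) (hy : -1 < y)
    (h : 0 ≤ x ∧ x ≤ y ∨ y ≤ x ∧ x ≤ 0) :
    1 / √(1 + x) + x / 2 ≤ 1 / √(1 + y) + y / 2 := by
  have ha : 0 < √(1 + x) := sqrt_pos.2 (by linarith)
  have hb : 0 < √(1 + y) := sqrt_pos.2 (by linarith)
  have hax : √(1 + x) ^ 2 = 1 + x := sq_sqrt (by linarith)
  have hby : √(1 + y) ^ 2 = 1 + y := sq_sqrt (by linarith)
  have hcmp : 1 ≤ √(1 + x) ∧ √(1 + x) ≤ √(1 + y) ∨ √(1 + y) ≤ √(1 + x) ∧ √(1 + x) ≤ 1 := by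
    rcases h with h | h
    · exact .inl ⟨one_le_sqrt.2 (by linarith), sqrt_le_sqrt (by linarith)⟩
    · exact .inr ⟨sqrt_le_sqrt (by linarith), sqrt_le_one.2 (by linarith)⟩
  generalize √(1 + x) = a at *
  generalize √(1 + y) = b at *
  obtain rfl : x = a ^ 2 - 1 := by linarith
  obtain rfl : y = b ^ 2 - 1 := by linarith
  have key : 0 ≤ (b - a) * ((a + b) * (a * b) - 2) := by
    rcases hcmp with ⟨h1, h2⟩ | ⟨h1, h2⟩
    · refine mul_nonneg (by linarith) ?_
      nlinarith [mul_le_mul h1 (h1.trans h2) zero_le_one ha.le]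
    · refine mul_nonneg_of_nonpos_of_nonpos (by linarith) ?_
      nlinarith [mul_le_one₀ h2 hb.le (h1.trans h2), mul_pos ha hb]
  have hid : 1 / b + (b ^ 2 - 1) / 2 - (1 / a + (a ^ 2 - 1) / 2) =
      (b - a) * ((a + b) * (a * b) - 2) / (2 * (a * b)) := by
    field_simp
    ring
  have : 0 ≤ (b - a) * ((a + b) * (a * b) - 2) / (2 * (a * b)) := by positivity
  linarith

/-- `√2` times the travel time, up to the boundary term `s sin θ / 2`. -/
lemma sqrt_two_mul_phaseTime {s : ℝ} (h0 : 0 ≤ s) (h1 : s < 1) (θ : ℝ) :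
    √2 * phaseTime s θ =
      (∫ φ in (0 : ℝ)..θ, (1 / √(1 + s * cos φ) + s * cos φ / 2)) - s * sin θ / 2 := by
  have hcont : Continuous fun φ => 1 / √(1 + s * cos φ) :=
    continuous_const.div (by fun_prop) fun φ => (sqrt_pos.2 (one_add_mul_cos_pos h0 h1 φ)).ne'
  have hcos : Continuous fun φ => s * cos φ / 2 := by fun_prop
  rw [intervalIntegral.integral_add (hcont.intervalIntegrable _ _) (hcos.intervalIntegrable _ _),
    intervalIntegral.integral_div, intervalIntegral.integral_const_mul, integral_cos, sin_zero,
    sub_zero, add_sub_cancel_right, phaseTime, ← intervalIntegral.integral_const_mul]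
  refine intervalIntegral.integral_congr fun φ _ => ?_
  have := sqrt_pos.2 (one_add_mul_cos_pos h0 h1 φ)
  simp only [phaseDensity]
  rw [sqrt_mul (by norm_num)]
  field_simp

lemma lobeTime_strictAntiOn_nonpos {c : ℝ} (hc : c ∈ Ioo (0 : ℝ) 1) :
    StrictAntiOn (lobeTime c) (Ioc (-1) 0) := by
  intro v hv w hw hvw
  have hv' : v ∈ Ioo (-1 : ℝ) 1 := ⟨hv.1, by linarith [hv.2]⟩
  have hw' : w ∈ Ioo (-1 : ℝ) 1 := ⟨hw.1, by linarith [hw.2]⟩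
  have hsv := modulus_pos hc v
  have hsw := modulus_pos hc w
  have hsv1 := modulus_lt_one hc hv'
  have hsw1 := modulus_lt_one hc hw'
  have hsq : w ^ 2 < v ^ 2 := by nlinarith [hw.2]
  have hle : modulus c w ≤ modulus c v := modulus_le_modulus hc hsq.le
  have hθw := endPhase_mem hc hw'
  have hθ := endPhase_strictAntiOn hc hv' hw' hvw
  have hcont : ∀ s : ℝ, 0 ≤ s → s < 1 →
      Continuous fun φ => 1 / √(1 + s * cos φ) + s * cos φ / 2 := fun s h0 h1 =>
    (continuous_const.div (by fun_prop) fun φ =>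
      (sqrt_pos.2 (one_add_mul_cos_pos h0 h1 φ)).ne').add (by fun_prop)
  have hint : (∫ φ in (0 : ℝ)..endPhase c w,
        (1 / √(1 + modulus c w * cos φ) + modulus c w * cos φ / 2)) ≤
      ∫ φ in (0 : ℝ)..endPhase c v,
        (1 / √(1 + modulus c v * cos φ) + modulus c v * cos φ / 2) := by
    refine (intervalIntegral.integral_mono_on hθw.1.le
      ((hcont _ hsw.le hsw1).intervalIntegrable _ _)
      ((hcont _ hsv.le hsv1).intervalIntegrable _ _) fun φ _ => ?_).trans
      (intervalIntegral.integral_mono_interval le_rfl hθw.1.le hθ.le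
        (Eventually.of_forall fun φ => ?_) ((hcont _ hsv.le hsv1).intervalIntegrable _ _))
    · refine invSqrt_add_half_le (by linarith [one_add_mul_cos_pos hsw.le hsw1 φ])
        (by linarith [one_add_mul_cos_pos hsv.le hsv1 φ]) ?_
      rcases le_total 0 (cos φ) with h | h
      · exact .inl ⟨mul_nonneg hsw.le h, mul_le_mul_of_nonneg_right hle h⟩
      · exact .inr ⟨mul_le_mul_of_nonpos_right hle h, mul_nonpos_of_nonneg_of_nonpos hsw.le h⟩
    · have := invSqrt_add_half_le (x := 0) (y := modulus c v * cos φ) (by norm_num)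
        (by linarith [one_add_mul_cos_pos hsv.le hsv1 φ])
        ((le_total 0 _).imp (⟨le_rfl, ·⟩) (⟨·, le_rfl⟩))
      norm_num at this
      simp only [Pi.zero_apply, one_div]
      linarith
  have hbd : √(c * (1 - v ^ 2)) < √(c * (1 - w ^ 2)) :=
    sqrt_lt_sqrt (mul_nonneg hc.1.le (by nlinarith [hv'.1, hv'.2]))
      (mul_lt_mul_of_pos_left (by linarith) hc.1)
  refine lt_of_mul_lt_mul_left (a := √2) ?_ (by positivity)
  rw [lobeTime, lobeTime, sqrt_two_mul_phaseTime hsw.le hsw1, sqrt_two_mul_phaseTime hsv.le hsv1,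
    modulus_mul_sin_endPhase hc hw', modulus_mul_sin_endPhase hc hv']
  linarith

lemma lobeTime_strictAntiOn {c : ℝ} (hc : c ∈ Ioo (0 : ℝ) 1) :
    StrictAntiOn (lobeTime c) (Ioo (-1) 1) := by
  have h := (lobeTime_strictAntiOn_nonpos hc).union (lobeTime_strictAntiOn_nonneg hc)
    (c := 0) ⟨⟨by norm_num, le_rfl⟩, fun x hx => hx.2⟩ ⟨⟨le_rfl, one_pos⟩, fun x hx => hx.1⟩
  rwa [Ioc_union_Ico_eq_Ioo (by norm_num) one_pos] at h

lemma continuous_modulus (c : ℝ) : Continuous (modulus c) := by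
  unfold modulus
  fun_prop

lemma continuous_lobeTime {c : ℝ} (hc : c ∈ Ioo (0 : ℝ) 1) :
    Continuous fun w : Ioo (-1 : ℝ) 1 => lobeTime c w := by
  have hm := continuous_modulus c
  refine intervalIntegral.continuous_parametric_intervalIntegral_of_continuous
    (f := fun (w : Ioo (-1 : ℝ) 1) θ => phaseDensity (modulus c w) θ) ?_ ?_
  · refine continuous_const.div (by fun_prop) fun x => ?_
    have := one_add_mul_cos_pos (modulus_pos hc x.1).le (modulus_lt_one hc x.1.2) x.2
    positivity
  · exact continuous_arccos.comp (continuous_subtype_val.div (by fun_prop)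
      fun w => (modulus_pos hc w).ne')

lemma continuous_endPhase {c : ℝ} (hc : c ∈ Ioo (0 : ℝ) 1) : Continuous (endPhase c) :=
  continuous_arccos.comp (continuous_id.div (continuous_modulus c) fun w => (modulus_pos hc w).ne')

lemma modulus_eq_one {c w : ℝ} (hw : w ^ 2 = 1) : modulus c w = 1 := by
  simp [modulus, hw]

lemma exists_lobeTime_le {c T : ℝ} (hc : c ∈ Ioo (0 : ℝ) 1) (hT : 0 < T) :
    ∃ w ∈ Ioo (-1 : ℝ) 1, lobeTime c w ≤ T := by
  have hlim : Tendsto (endPhase c) (𝓝[<] 1) (𝓝 0) := by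
    have h := (continuous_endPhase hc).tendsto 1
    rw [endPhase, modulus_eq_one (by norm_num), div_one, arccos_one] at h
    exact h.mono_left nhdsWithin_le_nhds
  obtain ⟨w, hwT, hw⟩ :=
    ((hlim.eventually_lt_const hT).and (Ioo_mem_nhdsLT one_pos)).exists
  have hw' : w ∈ Ioo (-1 : ℝ) 1 := ⟨by linarith [hw.1], hw.2⟩
  refine ⟨w, hw', le_trans ?_ hwT.le⟩
  have hs := modulus_pos hc w
  have hs1 := modulus_lt_one hc hw'
  have hθ := endPhase_mem hc hw'
  have h := intervalIntegral.integral_mono_on (μ := volume) hθ.1.le (g := fun _ => (1 : ℝ))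
    ((continuous_phaseDensity hs.le hs1).intervalIntegrable _ _) (by simp) fun φ hφ => by
      have h2 : φ ≤ π / 2 := hφ.2.trans (arccos_le_pi_div_two.2 (div_nonneg hw.1.le hs.le))
      have hcos := mul_nonneg hs.le (cos_nonneg_of_mem_Icc ⟨by linarith [hφ.1, pi_pos], h2⟩)
      exact div_le_one_of_le₀ (one_le_sqrt.2 (by linarith)) (sqrt_nonneg _)
  simpa [lobeTime, phaseTime] using h

lemma exists_le_lobeTime {c : ℝ} (hc : c ∈ Ioo (0 : ℝ) 1) (T : ℝ) :
    ∃ w ∈ Ioo (-1 : ℝ) 1, T ≤ lobeTime c w := by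
  set δ : ℝ := π / 2 / exp (2 * |T|) with hδ
  have hδ0 : 0 < δ := by positivity
  have hδ2 : δ ≤ π / 2 := div_le_self (by positivity) (one_le_exp (by positivity))
  have hθlim : Tendsto (endPhase c) (𝓝[>] (-1)) (𝓝 π) := by
    have h := (continuous_endPhase hc).tendsto (-1)
    rw [endPhase, modulus_eq_one (by norm_num), div_one, arccos_neg_one] at h
    exact h.mono_left nhdsWithin_le_nhds
  have hslim : Tendsto (modulus c) (𝓝[>] (-1)) (𝓝 1) := by
    have h := (continuous_modulus c).tendsto (-1)
    rw [modulus_eq_one (by norm_num)] at h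
    exact h.mono_left nhdsWithin_le_nhds
  obtain ⟨w, ⟨hwθ, hws⟩, hw⟩ :=
    (((hθlim.eventually_const_lt (show π - δ < π by linarith)).and
      (hslim.eventually_const_lt (show 1 - δ ^ 2 / 2 < 1 by nlinarith))).and
      (Ioo_mem_nhdsGT (show (-1 : ℝ) < 1 by norm_num))).exists
  refine ⟨w, hw, ?_⟩
  have hs := modulus_pos hc w
  have hs1 := modulus_lt_one hc hw
  have hcont := continuous_phaseDensity hs.le hs1
  have hlog : ∫ φ in δ..π / 2, (1 / 2) * (1 / φ) = |T| := by
    rw [intervalIntegral.integral_const_mul, integral_one_div_of_pos hδ0 (by positivity), hδ,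
      div_div_cancel₀ (by positivity), log_exp]
    ring
  have hflip := intervalIntegral.integral_comp_sub_left (a := δ) (b := π / 2)
    (phaseDensity (modulus c w)) π
  calc T ≤ |T| := le_abs_self T
    _ = ∫ φ in δ..π / 2, (1 / 2) * (1 / φ) := hlog.symm
    _ ≤ ∫ φ in δ..π / 2, phaseDensity (modulus c w) (π - φ) := by
      refine intervalIntegral.integral_mono_on hδ2 ?_
        ((hcont.comp (by fun_prop)).intervalIntegrable _ _) fun φ hφ => ?_
      · refine ContinuousOn.intervalIntegrable fun x hx => ?_
        rw [uIcc_of_le hδ2] at hx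
        have : x ≠ 0 := (hδ0.trans_le hx.1).ne'
        exact ContinuousAt.continuousWithinAt (by fun_prop (disch := assumption))
      · have hφ0 := hδ0.trans_le hφ.1
        have h := one_add_mul_cos_pos hs.le hs1 (π - φ)
        rw [cos_pi_sub] at h
        rw [phaseDensity, one_div_mul_one_div, cos_pi_sub]
        refine one_div_le_one_div_of_le (sqrt_pos.2 (by linarith)) ?_
        rw [sqrt_le_left (by linarith)]
        nlinarith [one_sub_sq_div_two_le_cos (x := φ), hφ.1, sq_nonneg φ,
          mul_nonneg hs.le (sub_nonneg.2 (one_sub_sq_div_two_le_cos (x := φ))),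
          mul_nonneg (sub_nonneg.2 hs1.le) (sq_nonneg φ), pow_le_pow_left₀ hδ0.le hφ.1 2]
    _ = phaseTime (modulus c w) (π - δ) - phaseTime (modulus c w) (π - π / 2) := by
      rw [hflip, phaseTime, phaseTime, intervalIntegral.integral_interval_sub_left
        (hcont.intervalIntegrable _ _) (hcont.intervalIntegrable _ _)]
    _ ≤ phaseTime (modulus c w) (π - δ) := by
      have := half_mul_le_phaseTime hs.le hs1 (show 0 ≤ π - π / 2 by linarith [pi_pos])
      linarith [pi_pos]
    _ ≤ lobeTime c w := (strictMono_phaseTime hs.le hs1).monotone hwθ.le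

lemma sq_one_div_two_mul_mem {N : ℕ} (hN : 1 ≤ N) :
    (1 / (2 * (N : ℝ))) ^ 2 ∈ Ioo (0 : ℝ) 1 := by
  have h : (1 : ℝ) ≤ N := by exact_mod_cast hN
  refine ⟨by positivity, pow_lt_one₀ (by positivity) ?_ two_ne_zero⟩
  rw [div_lt_one (by positivity)]
  linarith

lemma two_mul_sq_sub_one_mem {p : ℝ} (hp : p ∈ Ioo (0 : ℝ) 1) :
    2 * p ^ 2 - 1 ∈ Ioo (-1 : ℝ) 1 :=
  ⟨by nlinarith [hp.1], by nlinarith [hp.1, hp.2]⟩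

lemma A_nonneg {p : ℝ} (hp : p ∈ Ioo (0 : ℝ) 1) : 0 ≤ A p :=
  mul_nonneg (sq_nonneg p) (by nlinarith [hp.1, hp.2])

lemma sqrt_endPhase {c p : ℝ} (hc : c ∈ Ioo (0 : ℝ) 1) (hp : p ∈ Ioo (0 : ℝ) 1) :
    √((1 + modulus c (2 * p ^ 2 - 1) * cos (endPhase c (2 * p ^ 2 - 1))) / 2) = p := by
  rw [modulus_mul_cos_endPhase hc (two_mul_sq_sub_one_mem hp),
    show (1 + (2 * p ^ 2 - 1)) / 2 = p ^ 2 by ring, sqrt_sq hp.1.le]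

lemma calT_eq_lobeTime {N : ℕ} (hN : 1 ≤ N) {p : ℝ} (hp : p ∈ Ioo (0 : ℝ) 1) :
    calT N p = lobeTime ((1 / (2 * N)) ^ 2) (2 * p ^ 2 - 1) := by
  have hc := sq_one_div_two_mul_mem hN
  have hw := two_mul_sq_sub_one_mem hp
  have hE : (1 / (2 * (N : ℝ)) * √(A p)) ^ 2 - A p =
      (modulus ((1 / (2 * N)) ^ 2) (2 * p ^ 2 - 1) ^ 2 - 1) / 4 := by
    rw [mul_pow, sq_sqrt (A_nonneg hp), modulus_sq hc, A]
    ring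
  have hs := modulus_pos hc (2 * p ^ 2 - 1)
  have h := integral_eq_phaseTime hs (modulus_lt_one hc hw) (endPhase_mem hc hw)
  rw [sqrt_endPhase hc hp] at h
  rw [calT, Tplus, hE, lobeTime, ← h, pPlus, mul_div_cancel₀ _ four_ne_zero, add_sub_cancel,
    sqrt_sq hs.le]

lemma existsUnique_calT_eq {N : ℕ} (hN : 1 ≤ N) {T : ℝ} (hT : 0 < T) :
    ∃! p : ℝ, p ∈ Ioo (0 : ℝ) 1 ∧ calT N p = T := by
  have hc := sq_one_div_two_mul_mem hN
  obtain ⟨v, hv, hvT⟩ := exists_lobeTime_le hc hT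
  obtain ⟨v', hv', hvT'⟩ := exists_le_lobeTime hc T
  have : PreconnectedSpace (Ioo (-1 : ℝ) 1) := Subtype.preconnectedSpace isPreconnected_Ioo
  obtain ⟨⟨w, hw⟩, hwT⟩ := mem_range_of_exists_le_of_exists_ge (continuous_lobeTime hc)
    ⟨⟨v, hv⟩, hvT⟩ ⟨⟨v', hv'⟩, hvT'⟩
  have hp : √((1 + w) / 2) ∈ Ioo (0 : ℝ) 1 :=
    ⟨sqrt_pos.2 (by linarith [hw.1]), (sqrt_lt' one_pos).2 (by linarith [hw.2])⟩
  refine ⟨√((1 + w) / 2), ⟨hp, ?_⟩, fun p ⟨hq, hpT⟩ => ?_⟩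
  · rw [calT_eq_lobeTime hN hp, sq_sqrt (by linarith [hw.1]), ← hwT]
    congr 1
    ring
  · rw [calT_eq_lobeTime hN hq, ← hwT] at hpT
    have := (lobeTime_strictAntiOn hc).injOn (two_mul_sq_sub_one_mem hq) hw hpT
    rw [← this, show (1 + (2 * p ^ 2 - 1)) / 2 = p ^ 2 by ring, sqrt_sq hq.1.le]

/-- fix `N ≥ 1`. For every `ε > 0` there is exactly one `p₀ ∈ (0,1)` with
`𝒯(p₀) = πε`, and for this `p₀` there is an even `C²` solution `u` of
`−u'' + u − 2u³ = 0` on `(−πε, πε)` with `u(±πε) = p₀`,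
`u'(−πε) = −u'(πε) = (1/(2N))√A(p₀)`, `u > 0` on `[−πε, πε]`, and `u' < 0` on `(0, πε]`. -/
theorem single_lobe_symmetric_state (N : ℕ) (hN : 1 ≤ N) :
    ∀ ε : ℝ, 0 < ε →
      (∃! p₀ : ℝ, p₀ ∈ Set.Ioo (0 : ℝ) 1 ∧ calT N p₀ = π * ε) ∧
      (∀ p₀ ∈ Set.Ioo (0 : ℝ) 1, calT N p₀ = π * ε →
        ∃ u : ℝ → ℝ, ContDiff ℝ 2 u ∧
          (∀ z ∈ Set.Icc (-(π * ε)) (π * ε), u (-z) = u z) ∧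
          (∀ z ∈ Set.Ioo (-(π * ε)) (π * ε),
            -deriv (deriv u) z + u z - 2 * (u z) ^ 3 = 0) ∧
          u (-(π * ε)) = p₀ ∧ u (π * ε) = p₀ ∧
          deriv u (-(π * ε)) = 1 / (2 * (N : ℝ)) * Real.sqrt (A p₀) ∧
          deriv u (π * ε) = -(1 / (2 * (N : ℝ)) * Real.sqrt (A p₀)) ∧
          (∀ z ∈ Set.Icc (-(π * ε)) (π * ε), 0 < u z) ∧
          (∀ z ∈ Set.Ioc (0 : ℝ) (π * ε), deriv u z < 0)) := by
  intro ε hε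
  refine ⟨existsUnique_calT_eq hN (by positivity), fun p hp hT => ?_⟩
  have hc := sq_one_div_two_mul_mem hN
  have hw := two_mul_sq_sub_one_mem hp
  obtain ⟨u, hsmooth, heven, hode, hval, hleft, hright, hpos, hneg⟩ :=
    exists_lobe (modulus_pos hc _) (modulus_lt_one hc hw) (endPhase_mem hc hw)
  have hslope : √((1 / (2 * (N : ℝ))) ^ 2 * (1 - (2 * p ^ 2 - 1) ^ 2)) / 2 =
      1 / (2 * (N : ℝ)) * √(A p) := by
    rw [show (1 / (2 * (N : ℝ))) ^ 2 * (1 - (2 * p ^ 2 - 1) ^ 2) =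
      (2 * (1 / (2 * (N : ℝ)))) ^ 2 * A p by rw [A]; ring, sqrt_mul (sq_nonneg _),
      sqrt_sq (by positivity)]
    ring
  rw [sqrt_endPhase hc hp] at hval
  rw [modulus_mul_sin_endPhase hc hw, hslope] at hleft hright
  rw [calT_eq_lobeTime hN hp, lobeTime] at hT
  rw [hT] at hval hleft hright hneg
  exact ⟨u, hsmooth, fun z _ => heven z, fun z _ => hode z, (heven _).trans hval, hval, hleft,
    hright, fun z _ => hpos z, hneg⟩
end
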